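/- arXiv:1006.3115 — 8 statements merged into one kernel-verified Lean document; each statement's English description precedes it below -/
import Mathlib

section
/- Assume the model of a second-countable locally compact Hausdorff principal groupoid (X, ≈, G) with Haar system (λ_x). Let k ≥ 1 be an integer and let z ∈ X be such that the orbit [z] is locally closed in X. Assume {x_n} is a sequence in X such that [x_n] → [z] uniquely in X/G. Suppose {W_m} is a decreasing sequence of compact neighbourhoods of z forming a neighbourhood basis at z such that for each m, liminf_n λ_{x_n}(G^{W_m}) > (k−1)·λ_z(G^{W_m}). Then {x_n} converges k-times in X/G to z. -/
open MeasureTheory Filter Topology Set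
open scoped ENNReal

attribute [local instance] Classical.propDecidable

/-- A model of a second-countable locally compact Hausdorff principal groupoid
on the unit space `X`: an equivalence relation `R` on `X`, with the groupoid
`G = {(x,y) : X × X // R x y}` equipped with a (not necessarily subspace) topology
making it a second-countable locally compact Hausdorff space for which the range
map, source map, inversion and composition are continuous and the unit embedding
`x ↦ (x,x)` is a homeomorphism onto its image. -/
structure GroupoidModel (X : Type*) [TopologicalSpace X] where
  R : X → X → Prop
  equiv : Equivalence R
  top : TopologicalSpace {p : X × X // R p.1 p.2}
  secondCountable : @SecondCountableTopology {p : X × X // R p.1 p.2} top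
  locallyCompact : @LocallyCompactSpace {p : X × X // R p.1 p.2} top
  t2 : @T2Space {p : X × X // R p.1 p.2} top
  cont_r : @Continuous {p : X × X // R p.1 p.2} X top _ fun γ => γ.1.1
  cont_s : @Continuous {p : X × X // R p.1 p.2} X top _ fun γ => γ.1.2
  cont_inv : @Continuous {p : X × X // R p.1 p.2} {p : X × X // R p.1 p.2} top top
    fun γ => ⟨(γ.1.2, γ.1.1), equiv.symm γ.2⟩
  cont_comp : @Continuous
    {q : {p : X × X // R p.1 p.2} × {p : X × X // R p.1 p.2} // q.1.1.2 = q.2.1.1}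
    {p : X × X // R p.1 p.2}
    (@instTopologicalSpaceSubtype _ _ (@instTopologicalSpaceProd _ _ top top)) top
    fun q => ⟨(q.1.1.1.1, q.1.2.1.2), equiv.trans q.1.1.2 (by rw [q.2]; exact q.1.2.2)⟩
  unit_embedding : @IsEmbedding X {p : X × X // R p.1 p.2} _ top fun x => ⟨(x, x), equiv.refl x⟩

namespace GroupoidModel

variable {X : Type*} [TopologicalSpace X] (M : GroupoidModel X)

/-- `G^W = r⁻¹(W)`. -/
def GW (W : Set X) : Set {p : X × X // M.R p.1 p.2} := {γ | γ.1.1 ∈ W}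

/-- `G_z^W = r⁻¹(W) ∩ s⁻¹({z})`. -/
def GsW (z : X) (W : Set X) : Set {p : X × X // M.R p.1 p.2} := {γ | γ.1.2 = z ∧ γ.1.1 ∈ W}

/-- The orbit `[x]` of `x`. -/
def orbit (x : X) : Set X := {y | M.R y x}

/-- For `K ⊆ G` and `γ = (y,x) ∈ G`, the set `Kγ = {(w,x) : (w,y) ∈ K}`. -/
def translate (K : Set {p : X × X // M.R p.1 p.2}) (γ : {p : X × X // M.R p.1 p.2}) :
    Set {p : X × X // M.R p.1 p.2} :=
  {δ | ∃ h : M.R δ.1.1 γ.1.1, δ.1.2 = γ.1.2 ∧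
    (⟨(δ.1.1, γ.1.1), h⟩ : {p : X × X // M.R p.1 p.2}) ∈ K}

/-- A sequence in `G` tends to infinity if it eventually leaves every compact set. -/
def TendsToInfty (γ : ℕ → {p : X × X // M.R p.1 p.2}) : Prop :=
  ∀ K : Set {p : X × X // M.R p.1 p.2}, @IsCompact _ M.top K → ∀ᶠ n in atTop, γ n ∉ K

/-- `{x_n}` converges `k`-times in `X/G` to `z`. -/
def ConvergesKTimes (k : ℕ) (x : ℕ → X) (z : X) : Prop :=
  ∃ γ : Fin k → ℕ → {p : X × X // M.R p.1 p.2},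
    (∀ i n, (γ i n).1.2 = x n) ∧
    (∀ i, Tendsto (fun n => (γ i n).1.1) atTop (𝓝 z)) ∧
    ∀ i j : Fin k, i < j → ∃ d : ℕ → {p : X × X // M.R p.1 p.2},
      (∀ n, (d n).1 = ((γ j n).1.1, (γ i n).1.1)) ∧ M.TendsToInfty d

end GroupoidModel

/-- A (right) Haar system on the groupoid model `M`: a family of Radon measures
`λ_x` on `G` (with its Borel σ-algebra) supported exactly on `G_x = s⁻¹({x})`,
such that `x ↦ ∫ f dλ_x` is continuous and compactly supported for every
continuous compactly supported `f : G → ℝ`, and which is right invariant. -/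
structure HaarSystem {X : Type*} [TopologicalSpace X] (M : GroupoidModel X) where
  lam : X → @Measure {p : X × X // M.R p.1 p.2} (@borel _ M.top)
  finite_on_compacts : ∀ x (K : Set {p : X × X // M.R p.1 p.2}),
    @IsCompact _ M.top K → lam x K ≠ ⊤
  outer_regular : ∀ x (A : Set {p : X × X // M.R p.1 p.2}),
    @MeasurableSet _ (@borel _ M.top) A →
    lam x A = ⨅ (U : Set {p : X × X // M.R p.1 p.2}) (_ : A ⊆ U) (_ : @IsOpen _ M.top U), lam x U
  inner_regular : ∀ x (U : Set {p : X × X // M.R p.1 p.2}), @IsOpen _ M.top U →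
    lam x U = ⨆ (K : Set {p : X × X // M.R p.1 p.2}) (_ : K ⊆ U) (_ : @IsCompact _ M.top K), lam x K
  support_null : ∀ x, lam x {γ | γ.1.2 ≠ x} = 0
  support_pos : ∀ x (U : Set {p : X × X // M.R p.1 p.2}), @IsOpen _ M.top U →
    (U ∩ {γ | γ.1.2 = x}).Nonempty → 0 < lam x U
  integral_continuous : ∀ f : {p : X × X // M.R p.1 p.2} → ℝ,
    @Continuous _ _ M.top _ f → @HasCompactSupport _ _ M.top _ f →
    Continuous fun x => ∫ γ, f γ ∂(lam x)
  integral_compactSupport : ∀ f : {p : X × X // M.R p.1 p.2} → ℝ,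
    @Continuous _ _ M.top _ f → @HasCompactSupport _ _ M.top _ f →
    HasCompactSupport fun x => ∫ γ, f γ ∂(lam x)
  invariance : ∀ f : {p : X × X // M.R p.1 p.2} → ℝ,
    @Continuous _ _ M.top _ f → @HasCompactSupport _ _ M.top _ f →
    ∀ γ : {p : X × X // M.R p.1 p.2},
      (∫ α, (if h : M.R α.1.1 γ.1.2 then
          f ⟨(α.1.1, γ.1.2), h⟩ else 0) ∂(lam γ.1.1))
        = ∫ α, f α ∂(lam γ.1.2)

namespace GroupoidModel

variable {X : Type*} [TopologicalSpace X] (M : GroupoidModel X)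

/-- The arrow space of the groupoid, as a type synonym carrying the groupoid topology and its
Borel σ-algebra rather than the subspace topology. -/
def Arrow : Type _ := {p : X × X // M.R p.1 p.2}

instance : TopologicalSpace M.Arrow := M.top
instance : SecondCountableTopology M.Arrow := M.secondCountable
instance : LocallyCompactSpace M.Arrow := M.locallyCompact
instance : T2Space M.Arrow := M.t2
instance : MeasurableSpace M.Arrow := borel M.Arrow
instance : BorelSpace M.Arrow := ⟨rfl⟩

variable {M}

/-- The pair `(range, source)` of an arrow. -/
def Arrow.ends (α : M.Arrow) : X × X := α.1

theorem Arrow.rel (α : M.Arrow) : M.R α.ends.1 α.ends.2 := α.2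

/-- The arrow `(a, b)`. -/
def Arrow.mk {a b : X} (h : M.R a b) : M.Arrow := ⟨(a, b), h⟩

theorem Arrow.continuous_ends : Continuous (Arrow.ends : M.Arrow → X × X) :=
  Continuous.prodMk (f := fun α : M.Arrow => α.1.1) (g := fun α : M.Arrow => α.1.2)
    M.cont_r M.cont_s

/-- Right multiplication by the arrow `(y, x)`, from the source fibre over `y` to that over `x`. -/
def Arrow.rightMul {y x : X} (h : M.R y x) (α : {α : M.Arrow // α.ends.2 = y}) : M.Arrow :=
  Arrow.mk (M.equiv.trans α.1.rel (by rw [α.2]; exact h))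

theorem Arrow.continuous_rightMul {y x : X} (h : M.R y x) :
    Continuous (Arrow.rightMul h) := by
  have h1 : Continuous fun α : {α : M.Arrow // α.ends.2 = y} =>
      (⟨(α.1, Arrow.mk h), α.2⟩ : {q : M.Arrow × M.Arrow // q.1.1.2 = q.2.1.1}) :=
    Continuous.subtype_mk (by fun_prop) _
  have h2 : Continuous fun q : {q : M.Arrow × M.Arrow // q.1.1.2 = q.2.1.1} =>
      (Arrow.mk (M.equiv.trans q.1.1.2 (by rw [q.2]; exact q.1.2.2)) : M.Arrow) :=
    M.cont_comp
  exact h2.comp h1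

theorem Arrow.isClosed_source_fibre [T2Space X] (y : X) :
    IsClosed {α : M.Arrow | α.ends.2 = y} :=
  isClosed_singleton.preimage (continuous_snd.comp Arrow.continuous_ends)

end GroupoidModel

theorem MeasureTheory.ofReal_integral_le_lintegral {α : Type*} [MeasurableSpace α]
    (μ : Measure α) {f : α → ℝ} (hf : ∀ a, 0 ≤ f a) :
    ENNReal.ofReal (∫ a, f a ∂μ) ≤ ∫⁻ a, ENNReal.ofReal (f a) ∂μ := by
  by_cases h : Integrable f μ
  · exact (ofReal_integral_eq_lintegral_ofReal h (ae_of_all _ hf)).le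
  · simp [integral_undef h]

namespace HaarSystem

open GroupoidModel

variable {X : Type*} [TopologicalSpace X] {M : GroupoidModel X}
  (H : HaarSystem M)

/-- The Haar measure over `x`, as a measure on `M.Arrow`. -/
def haar (x : X) : Measure M.Arrow := H.lam x

instance (x : X) : IsFiniteMeasureOnCompacts (H.haar x) :=
  ⟨fun K hK => (H.finite_on_compacts x K hK).lt_top⟩

theorem exists_isOpen_haar_lt (x : X) {A : Set M.Arrow} (hA : MeasurableSet A) {b : ℝ≥0∞}
    (hb : H.haar x A < b) : ∃ U, A ⊆ U ∧ IsOpen U ∧ H.haar x U < b := by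
  have h := H.outer_regular x A hA
  have hb' : H.lam x A < b := hb
  rw [h] at hb'
  simp only [iInf_lt_iff, exists_prop] at hb'
  exact hb'

theorem haar_source_ne (x : X) : H.haar x {α | α.ends.2 ≠ x} = 0 := H.support_null x

theorem haar_le_ofReal_integral (x : X) {C : Set M.Arrow} (hC : IsCompact C)
    (f : C(M.Arrow, ℝ)) (hf1 : EqOn f 1 C) (hfc : HasCompactSupport f)
    (hf : ∀ α, f α ∈ Icc (0 : ℝ) 1) :
    H.haar x C ≤ ENNReal.ofReal (∫ α, f α ∂H.haar x) := by
  rw [ofReal_integral_eq_lintegral_ofReal (f.continuous.integrable_of_hasCompactSupport hfc)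
    (ae_of_all _ fun α => (hf α).1), ← lintegral_indicator_one hC.measurableSet]
  refine lintegral_mono fun α => ?_
  by_cases hα : α ∈ C
  · simp [hα, hf1 hα]
  · simp [hα]

theorem ofReal_integral_le_haar (x : X) {U : Set M.Arrow} (hU : MeasurableSet U)
    (g : M.Arrow → ℝ) (hg : ∀ α, g α ∈ Icc (0 : ℝ) 1)
    (hgU : ∀ α, α.ends.2 = x → α ∉ U → g α = 0) :
    ENNReal.ofReal (∫ α, g α ∂H.haar x) ≤ H.haar x U := by
  refine (ofReal_integral_le_lintegral _ fun α => (hg α).1).trans ?_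
  rw [← lintegral_indicator_one hU]
  refine lintegral_mono_ae ?_
  have hx : ∀ᵐ α ∂H.haar x, α.ends.2 = x := H.haar_source_ne x
  filter_upwards [hx] with α hα
  by_cases h : α ∈ U
  · simpa [h] using (hg α).2
  · simp [h, hgU α hα h]

/-- On compact sets, the Haar measures are upper semicontinuous in the base point. -/
theorem eventually_haar_lt {C : Set M.Arrow} (hC : IsCompact C) {x : X} {b : ℝ≥0∞}
    (hb : H.haar x C < b) : ∀ᶠ y in 𝓝 x, H.haar y C < b := by
  obtain ⟨U, hCU, hU, hUb⟩ := H.exists_isOpen_haar_lt x hC.measurableSet hb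
  obtain ⟨f, hf1, hf0, hfc, hf⟩ := exists_continuous_one_zero_of_isCompact hC hU.isClosed_compl
    (disjoint_compl_right_iff_subset.mpr hCU)
  have hcont : Continuous fun y => ENNReal.ofReal (∫ α, f α ∂H.haar y) :=
    ENNReal.continuous_ofReal.comp (H.integral_continuous f f.continuous hfc)
  have hlt : ENNReal.ofReal (∫ α, f α ∂H.haar x) < b :=
    (H.ofReal_integral_le_haar x hU.measurableSet f hf fun α _ hα => hf0 hα).trans_lt hUb
  filter_upwards [hcont.tendsto x |>.eventually_lt_const hlt] with y hy
  exact (H.haar_le_ofReal_integral y hC f hf1 hfc hf).trans_lt hy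

/-- If the translate of the source fibre `A ∩ G_x` by `(x, y)` lies in `B`, then
`λ_x A ≤ λ_y B`. -/
theorem haar_le_of_rightMul_mem [T2Space X] {x y : X} (h : M.R x y) {A B : Set M.Arrow}
    (hA : IsCompact A) (hB : MeasurableSet B)
    (hAB : ∀ α : {α : M.Arrow // α.ends.2 = x}, α.1 ∈ A → Arrow.rightMul h α ∈ B) :
    H.haar x A ≤ H.haar y B := by
  refine le_of_forall_gt fun b hb => ?_
  obtain ⟨U, hBU, hU, hUb⟩ := H.exists_isOpen_haar_lt y hB hb
  refine lt_of_le_of_lt ?_ hUb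
  obtain ⟨V, hV, hVU⟩ := isOpen_induced_iff.mp (hU.preimage (Arrow.continuous_rightMul h))
  have hmem : ∀ α : {α : M.Arrow // α.ends.2 = x}, α.1 ∈ V ↔ Arrow.rightMul h α ∈ U :=
    fun α => Set.ext_iff.mp hVU α
  have hA' : IsCompact (A ∩ {α | α.ends.2 = x}) := hA.inter_right (Arrow.isClosed_source_fibre x)
  have hAV : A ∩ {α | α.ends.2 = x} ⊆ V := fun α hα =>
    (hmem ⟨α, hα.2⟩).mpr (hBU (hAB ⟨α, hα.2⟩ hα.1))
  obtain ⟨f, hf1, hf0, hfc, hf⟩ := exists_continuous_one_zero_of_isCompact hA' hV.isClosed_compl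
    (disjoint_compl_right_iff_subset.mpr hAV)
  have hnull : H.haar x A ≤ H.haar x (A ∩ {α | α.ends.2 = x}) := by
    refine measure_mono_ae ?_
    have hx : ∀ᵐ α ∂H.haar x, α.ends.2 = x := H.haar_source_ne x
    filter_upwards [hx] with α hα hαA using ⟨hαA, hα⟩
  refine hnull.trans ((H.haar_le_ofReal_integral x hA' f hf1 hfc hf).trans ?_)
  have hinv : (∫ α : M.Arrow, (if h' : M.R α.ends.1 x then f (Arrow.mk h') else 0) ∂H.haar y) =
      ∫ α, f α ∂H.haar x :=
    H.invariance f f.continuous hfc (Arrow.mk (M.equiv.symm h))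
  rw [← hinv]
  refine H.ofReal_integral_le_haar y hU.measurableSet _ (fun α => ?_) fun α hα hαU => ?_
  · split_ifs with h'
    · exact hf _
    · simp
  · split_ifs with h'
    · refine hf0 fun hαV => hαU ?_
      have heq : Arrow.rightMul h ⟨Arrow.mk h', rfl⟩ = α := Subtype.ext (Prod.ext rfl hα.symm)
      rw [← heq]
      exact (hmem ⟨Arrow.mk h', rfl⟩).mp hαV
    · rfl

end HaarSystem

/-- There is a sequence of `k` points of `S`, no later one being `P`-related to an earlier one. -/
def HasAvoidingTuple {X : Type*} (P : Set (X × X)) (S : Set X) (k : ℕ) : Prop :=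
  ∃ y : Fin k → X, (∀ i, y i ∈ S) ∧ ∀ i j, i < j → (y j, y i) ∉ P

theorem HasAvoidingTuple.mono {X : Type*} {P Q : Set (X × X)} {S T : Set X} {k : ℕ}
    (h : HasAvoidingTuple P S k) (hQ : Q ⊆ P) (hS : S ⊆ T) : HasAvoidingTuple Q T k := by
  obtain ⟨y, hy, hyP⟩ := h
  exact ⟨y, fun i => hS (hy i), fun i j hij hQij => hyP i j hij (hQ hQij)⟩

/-- If there is no avoiding `k`-tuple, then fewer than `k` points dominate the whole set. -/
theorem exists_dominating_of_not_hasAvoidingTuple {X : Type*} {P : Set (X × X)} {S : Set X}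
    {k : ℕ} (h : ¬ HasAvoidingTuple P S k) :
    ∃ l < k, ∃ y : Fin l → X, (∀ i, y i ∈ S) ∧ ∀ w ∈ S, ∃ i, (w, y i) ∈ P := by
  contrapose! h
  suffices ∀ l ≤ k, HasAvoidingTuple P S l from this k le_rfl
  intro l
  induction l with
  | zero => exact fun _ => ⟨Fin.elim0, fun i => i.elim0, fun i => i.elim0⟩
  | succ l ih =>
    intro hl
    obtain ⟨y, hy, hyP⟩ := ih (by omega)
    obtain ⟨w, hw, hwP⟩ := h l (by omega) y hy
    refine ⟨Fin.snoc y w, fun i => ?_, fun i j => ?_⟩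
    · refine Fin.lastCases ?_ (fun i => ?_) i <;> simp [hw, hy]
    · refine Fin.lastCases ?_ (fun i => ?_) i <;> refine Fin.lastCases ?_ (fun j => ?_) j
      · simp
      · exact fun hij => absurd hij (Fin.castSucc_lt_last j).not_gt
      · intro _
        simpa using hwP i
      · intro hij
        simpa using hyP i j (by simpa using hij)

namespace GroupoidModel

variable {X : Type*} [TopologicalSpace X] {M : GroupoidModel X}

theorem isCompact_image_ends {K : Set M.Arrow} (hK : IsCompact K) :
    IsCompact (Arrow.ends '' K) := hK.image Arrow.continuous_ends

/-- If `z` is in the closure of a set `S` disjoint from `[z]`, then `S` contains avoiding tuples of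
any length. -/
theorem hasAvoidingTuple_of_mem_closure [T2Space X] {K : Set M.Arrow} (hK : IsCompact K) {z : X}
    {S : Set X} (hS : ∀ y ∈ S, y ∉ M.orbit z) (hz : z ∈ closure S) (k : ℕ) :
    HasAvoidingTuple (Arrow.ends '' K) S k := by
  by_contra h
  obtain ⟨l, -, y, hy, hdom⟩ := exists_dominating_of_not_hasAvoidingTuple h
  have hclosed := (isCompact_image_ends hK).isClosed
  have hev : ∀ᶠ w in 𝓝 z, ∀ i, (w, y i) ∉ Arrow.ends '' K := by
    refine eventually_all.mpr fun i => ?_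
    have hcont : Continuous fun w : X => (w, y i) := by fun_prop
    refine (hcont.tendsto z).eventually (hclosed.isOpen_compl.mem_nhds ?_)
    rintro ⟨α, -, hα⟩
    have hrel := α.rel
    rw [hα] at hrel
    exact hS _ (hy i) (M.equiv.symm hrel)
  obtain ⟨w, hw, hwS⟩ := mem_closure_iff_nhds.mp hz _ hev
  obtain ⟨i, hi⟩ := hdom w hwS
  exact hw i hi

/-- Avoiding tuples of limits of the orbits `[x_n]` can be approximated inside `[x_n]`. -/
theorem eventually_hasAvoidingTuple [T2Space X] {ι : Type*} {F : Filter ι} {x : ι → X}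
    {P : Set (X × X)} (hP : IsClosed P) {V S : Set X} (hV : IsOpen V) (hSV : S ⊆ V)
    (hS : ∀ y ∈ S, ∀ U ∈ 𝓝 y, ∀ᶠ n in F, (U ∩ M.orbit (x n)).Nonempty) {k : ℕ}
    (h : HasAvoidingTuple P S k) :
    ∀ᶠ n in F, HasAvoidingTuple P (V ∩ M.orbit (x n)) k := by
  obtain ⟨y, hy, hyP⟩ := h
  have hmem : {u : Fin k → X | (∀ i, u i ∈ V) ∧ ∀ i j, i < j → (u j, u i) ∉ P} ∈ 𝓝 y := by
    refine (eventually_all.mpr fun i => ?_).and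
      (eventually_all.mpr fun i => eventually_all.mpr fun j => eventually_all.mpr fun hij => ?_)
    · exact (continuous_apply i).tendsto y |>.eventually (hV.mem_nhds (hSV (hy i)))
    · have hcont : Continuous fun u : Fin k → X => (u j, u i) := by fun_prop
      exact (hcont.tendsto y).eventually (hP.isOpen_compl.mem_nhds (hyP i j hij))
  rw [nhds_pi, Filter.mem_pi] at hmem
  obtain ⟨I, -, t, ht, htsub⟩ := hmem
  filter_upwards [eventually_all.mpr fun i => hS (y i) (hy i) (t i) (ht i)] with n hn
  choose u hu using hn
  obtain ⟨huV, huP⟩ := htsub (show u ∈ I.pi t from fun i _ => (hu i).1)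
  exact ⟨u, fun i => ⟨huV i, (hu i).2⟩, huP⟩

end GroupoidModel

namespace HaarSystem

open GroupoidModel

variable {X : Type*} [TopologicalSpace X] [T2Space X] {M : GroupoidModel X} (H : HaarSystem M)

/-- If finitely many points `y i` of `[x]` dominate `[x] ∩ W` through `K`, then `λ_x(G^W)` is at
most the sum of the `λ_{y i}(K ∩ G^W)`. -/
theorem haar_GW_le_sum {K : Set M.Arrow} (hK : IsCompact K) {W : Set X} (hW : IsClosed W)
    {x : X} {l : ℕ} {y : Fin l → X} (hy : ∀ i, M.R (y i) x)
    (hdom : ∀ w ∈ W ∩ M.orbit x, ∃ i, (w, y i) ∈ Arrow.ends '' K) :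
    H.haar x (M.GW W) ≤ ∑ i, H.haar (y i) (K ∩ {α | α.ends.1 ∈ W}) := by
  have hC : IsCompact (K ∩ {α | α.ends.1 ∈ W}) :=
    hK.inter_right (hW.preimage (continuous_fst.comp Arrow.continuous_ends))
  let A : Fin l → Set M.Arrow := fun i =>
    Arrow.rightMul (hy i) '' (Subtype.val ⁻¹' (K ∩ {α | α.ends.1 ∈ W}))
  have hA : ∀ i, IsCompact (A i) := fun i =>
    ((Arrow.isClosed_source_fibre (y i)).isClosedEmbedding_subtypeVal.isCompact_preimage hC).image
      (Arrow.continuous_rightMul (hy i))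
  have hcover : H.haar x (M.GW W) ≤ H.haar x (⋃ i, A i) := by
    refine measure_mono_ae ?_
    have hx : ∀ᵐ α ∂H.haar x, α.ends.2 = x := H.haar_source_ne x
    filter_upwards [hx] with α hα hαW
    have hαx : M.R α.ends.1 x := by
      have := α.rel
      rwa [hα] at this
    have hαW' : α.ends.1 ∈ W := hαW
    obtain ⟨i, κ, hκ, hκα⟩ := hdom α.ends.1 ⟨hαW', hαx⟩
    refine mem_iUnion.mpr ⟨i, ⟨κ, by rw [hκα]⟩, ⟨hκ, ?_⟩, ?_⟩
    · change κ.ends.1 ∈ W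
      rwa [hκα]
    · have hκα₁ : κ.ends.1 = α.ends.1 := by rw [hκα]
      exact Subtype.ext (Prod.ext hκα₁ hα.symm)
  refine hcover.trans ((measure_iUnion_fintype_le _ A).trans (Finset.sum_le_sum fun i _ => ?_))
  refine H.haar_le_of_rightMul_mem (M.equiv.symm (hy i)) (hA i) hC.measurableSet ?_
  rintro ⟨_, hα⟩ ⟨κ, hκ, rfl⟩
  have hκy : y i = κ.1.ends.2 := κ.2.symm
  have heq : Arrow.rightMul (M.equiv.symm (hy i)) ⟨Arrow.rightMul (hy i) κ, hα⟩ = κ.1 :=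
    Subtype.ext (Prod.ext rfl hκy)
  rw [heq]
  exact hκ

/-- The measure condition at a basis of compact neighbourhoods produces avoiding tuples. -/
theorem eventually_hasAvoidingTuple {k : ℕ} (hk : 1 ≤ k) {z : X} {x : ℕ → X} {W : ℕ → Set X}
    (hWcpt : ∀ m, IsCompact (W m)) (hWnhd : ∀ m, W m ∈ 𝓝 z) (hWbasis : ∀ U ∈ 𝓝 z, ∃ m, W m ⊆ U)
    (hliminf : ∀ m, ((k - 1 : ℕ) : ℝ≥0∞) * H.haar z (M.GW (W m))
      < liminf (fun n => H.haar (x n) (M.GW (W m))) atTop)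
    {K : Set M.Arrow} (hK : IsCompact K) (m : ℕ) :
    ∀ᶠ n in atTop, HasAvoidingTuple (Arrow.ends '' K) (W m ∩ M.orbit (x n)) k := by
  by_contra hnot
  obtain ⟨u, hu, hunot⟩ : ∃ u : Ultrafilter ℕ, (u : Filter ℕ) ≤ atTop ∧
      ∀ᶠ n in u, ¬ HasAvoidingTuple (Arrow.ends '' K) (W m ∩ M.orbit (x n)) k := by
    by_contra hall
    refine hnot (mem_iff_ultrafilter.mpr fun u hu => ?_)
    by_contra hmem
    exact hall ⟨u, hu, u.eventually_not.mpr hmem⟩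
  have hPclosed := (isCompact_image_ends hK).isClosed
  let L : Set X := {y | ∀ U ∈ 𝓝 y, ∀ᶠ n in u, (U ∩ M.orbit (x n)).Nonempty}
  by_cases hcl : z ∈ closure (interior (W m) ∩ (L \ M.orbit z))
  · have htuple := hasAvoidingTuple_of_mem_closure hK (fun y hy => hy.2.2) hcl k
    have hev := GroupoidModel.eventually_hasAvoidingTuple hPclosed isOpen_interior
      inter_subset_left (fun y hy => hy.2.1) htuple
    obtain ⟨n, hn, hn'⟩ := (hunot.and hev).exists
    exact hn (hn'.mono subset_rfl (inter_subset_inter_left _ interior_subset))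
  obtain ⟨m', hm'⟩ : ∃ m', W m' ⊆ W m ∧ W m' ∩ L ⊆ M.orbit z := by
    rw [mem_closure_iff_nhds] at hcl
    push Not at hcl
    obtain ⟨t, ht, hdisj⟩ := hcl
    obtain ⟨m', hm'⟩ := hWbasis _ (inter_mem ht (interior_mem_nhds.mpr (hWnhd m)))
    refine ⟨m', fun y hy => interior_subset (hm' hy).2, fun y hy => ?_⟩
    by_contra hyz
    exact eq_empty_iff_forall_notMem.mp hdisj y
      ⟨(hm' hy.1).1, (hm' hy.1).2, hy.2, hyz⟩
  obtain ⟨c, hzc, hc⟩ := exists_between (hliminf m')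
  have hcu : ∀ᶠ n in u, c < H.haar (x n) (M.GW (W m')) := hu (eventually_lt_of_lt_liminf hc)
  have hWclosed := (hWcpt m').isClosed
  have hGW : IsClosed {α : M.Arrow | α.ends.1 ∈ W m'} :=
    hWclosed.preimage (continuous_fst.comp Arrow.continuous_ends)
  have hC : IsCompact (K ∩ {α | α.ends.1 ∈ W m'}) := hK.inter_right hGW
  obtain ⟨b, hb, hbc⟩ : ∃ b : ℝ≥0∞, (k = 1 ∨ H.haar z (M.GW (W m')) < b) ∧
      ((k - 1 : ℕ) : ℝ≥0∞) * b ≤ c := by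
    rcases hk.eq_or_lt with rfl | hk1
    · exact ⟨0, Or.inl rfl, by simp⟩
    · refine ⟨c / ((k - 1 : ℕ) : ℝ≥0∞), Or.inr ?_, ENNReal.mul_div_le⟩
      rw [ENNReal.lt_div_iff_mul_lt (Or.inl (by exact_mod_cast (by omega : k - 1 ≠ 0))) (Or.inl (by simp)), mul_comm]
      exact hzc
  have hbound : ∀ᶠ n in u, k = 1 ∨
      ∀ y ∈ W m' ∩ M.orbit (x n), H.haar y (K ∩ {α | α.ends.1 ∈ W m'}) < b := by
    rcases hb with hk1 | hb
    · exact Eventually.of_forall fun _ => Or.inl hk1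
    by_contra hneg
    rw [← u.eventually_not] at hneg
    have hex : ∀ᶠ n in u, ∃ y, y ∈ W m' ∩ M.orbit (x n) ∧
        b ≤ H.haar y (K ∩ {α | α.ends.1 ∈ W m'}) := by
      filter_upwards [hneg] with n hn
      push Not at hn
      exact hn.2
    obtain ⟨y, hy⟩ := hex.choice
    obtain ⟨y₀, hy₀, hlim⟩ := (hWcpt m').ultrafilter_le_nhds (u.map y)
      (le_principal_iff.mpr (hy.mono fun n hn => hn.1.1))
    have hyL : y₀ ∈ L := fun U hU => by
      filter_upwards [hlim hU, hy] with n hn hn' using ⟨y n, hn, hn'.1.2⟩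
    have hle : H.haar y₀ (K ∩ {α | α.ends.1 ∈ W m'}) ≤ H.haar z (M.GW (W m')) :=
      H.haar_le_of_rightMul_mem (hm'.2 ⟨hy₀, hyL⟩) hC hGW.measurableSet fun α hα => hα.2
    have hlt : ∀ᶠ n in u, H.haar (y n) (K ∩ {α | α.ends.1 ∈ W m'}) < b :=
      hlim (H.eventually_haar_lt hC (hle.trans_lt hb))
    obtain ⟨n, hn, hn'⟩ := (hlt.and hy).exists
    exact hn'.2.not_gt hn
  obtain ⟨n, hn, hcn, hbn⟩ := (hunot.and (hcu.and hbound)).exists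
  obtain ⟨l, hl, y, hy, hdom⟩ := exists_dominating_of_not_hasAvoidingTuple
    fun h => hn (h.mono subset_rfl (inter_subset_inter_left _ hm'.1))
  refine hcn.not_ge ((H.haar_GW_le_sum hK hWclosed (fun i => (hy i).2) hdom).trans ?_)
  rcases hbn with hk1 | hbn
  · obtain rfl : l = 0 := by omega
    simp
  · calc ∑ i, H.haar (y i) (K ∩ {α | α.ends.1 ∈ W m'}) ≤ ∑ _i : Fin l, b :=
          Finset.sum_le_sum fun i _ => (hbn (y i) (hy i)).le
      _ = (l : ℝ≥0∞) * b := by simp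
      _ ≤ ((k - 1 : ℕ) : ℝ≥0∞) * b := by gcongr; omega
      _ ≤ c := hbc

end HaarSystem

/-- Diagonal choice: if each `p m` holds eventually, then so does `p (μ n) n` for some `μ → ∞`. -/
theorem exists_tendsto_atTop_eventually {p : ℕ → ℕ → Prop} (hp : ∀ m, ∀ᶠ n in atTop, p m n) :
    ∃ μ : ℕ → ℕ, Tendsto μ atTop atTop ∧ ∀ᶠ n in atTop, p (μ n) n := by
  refine ⟨fun n => Nat.findGreatest (fun m => p m n) n, tendsto_atTop.mpr fun m => ?_, ?_⟩
  · filter_upwards [hp m, eventually_ge_atTop m] with n hn hmn using Nat.le_findGreatest hmn hn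
  · filter_upwards [hp 0] with n hn using
      Nat.findGreatest_spec (P := fun m => p m n) (Nat.zero_le n) hn

/-- In the model of a second-countable locally compact Hausdorff
principal groupoid `(X, ≈, G)` with Haar system `(λ_x)`: let `k ≥ 1`, let `z ∈ X`
have locally closed orbit, and let `{x_n}` satisfy `[x_n] → [z]` uniquely in `X/G`.
If `{W_m}` is a decreasing sequence of compact neighbourhoods of `z` forming a
neighbourhood basis at `z` with
`liminf_n λ_{x_n}(G^{W_m}) > (k−1)·λ_z(G^{W_m})` for each `m`, then `{x_n}`
converges `k`-times in `X/G` to `z`. -/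
theorem convergesKTimes_of_liminf_measure {X : Type*} [TopologicalSpace X]
    [SecondCountableTopology X] [LocallyCompactSpace X] [T2Space X]
    (M : GroupoidModel X) (H : HaarSystem M)
    (k : ℕ) (hk : 1 ≤ k) (z : X) (hz : IsLocallyClosed (M.orbit z))
    (x : ℕ → X)
    (hconv : Tendsto (fun n => Quot.mk M.R (x n)) atTop (𝓝 (Quot.mk M.R z)))
    (huniq : ∀ w : Quot M.R,
      Tendsto (fun n => Quot.mk M.R (x n)) atTop (𝓝 w) → w = Quot.mk M.R z)
    (W : ℕ → Set X) (hWcpt : ∀ m, IsCompact (W m)) (hWnhd : ∀ m, W m ∈ 𝓝 z)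
    (hWmono : Antitone W) (hWbasis : ∀ U ∈ 𝓝 z, ∃ m, W m ⊆ U)
    (hliminf : ∀ m, ((k - 1 : ℕ) : ℝ≥0∞) * H.lam z (M.GW (W m))
      < Filter.liminf (fun n => H.lam (x n) (M.GW (W m))) atTop) :
    M.ConvergesKTimes k x z := by
  let E : CompactExhaustion M.Arrow := default
  obtain ⟨μ, hμ, hp⟩ := exists_tendsto_atTop_eventually fun m =>
    H.eventually_hasAvoidingTuple hk hWcpt hWnhd hWbasis hliminf (E.isCompact m) m
  have hex : ∀ n, ∃ y : Fin k → X, (∀ i, M.R (y i) (x n)) ∧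
      (HasAvoidingTuple (GroupoidModel.Arrow.ends '' E (μ n)) (W (μ n) ∩ M.orbit (x n)) k →
        (∀ i, y i ∈ W (μ n)) ∧
          ∀ i j, i < j → (y j, y i) ∉ GroupoidModel.Arrow.ends '' E (μ n)) := by
    intro n
    by_cases h : HasAvoidingTuple (GroupoidModel.Arrow.ends '' E (μ n))
        (W (μ n) ∩ M.orbit (x n)) k
    · obtain ⟨y, hy, hyP⟩ := h
      exact ⟨y, fun i => (hy i).2, fun _ => ⟨fun i => (hy i).1, hyP⟩⟩
    · exact ⟨fun _ => x n, fun _ => M.equiv.refl _, fun h' => absurd h' h⟩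
  choose y hyx hy using hex
  refine ⟨fun i n => ⟨(y n i, x n), hyx n i⟩, fun _ _ => rfl, fun i U hU => ?_, fun i j hij =>
    ⟨fun n => ⟨(y n j, y n i), M.equiv.trans (hyx n j) (M.equiv.symm (hyx n i))⟩,
      fun _ => rfl, fun K hK => ?_⟩⟩
  · obtain ⟨m, hm⟩ := hWbasis U hU
    change ∀ᶠ n in atTop, y n i ∈ U
    filter_upwards [hp, hμ.eventually_ge_atTop m] with n hn hmn
    exact hm (hWmono hmn ((hy n hn).1 i))
  · obtain ⟨m, hm⟩ := E.exists_superset_of_isCompact (s := K) hK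
    filter_upwards [hp, hμ.eventually_ge_atTop m] with n hn hmn hmem
    exact (hy n hn).2 i j hij ⟨_, E.subset hmn (hm hmem), rfl⟩
end

section
/- Assume the model of a second-countable locally compact Hausdorff principal groupoid (X, ≈, G) with Haar system (λ_x). Suppose z ∈ X is such that the orbit [z] is locally closed in X, and {x_n} is a sequence in X such that for every open neighbourhood V of z with G_z^V relatively compact, λ_{x_n}(G^V) → ∞ as n → ∞. Then for every integer k ≥ 1 the sequence {x_n} converges k-times in X/G to z. -/
open MeasureTheory Filter Topology Set
open scoped ENNReal

attribute [local instance] Classical.propDecidable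

/-- If every `B a` with `a ∈ S` has measure at most `C` and `k * C < μ S`, then `S` contains `k`
points none of which lies in the sets `B` attached to the previous ones. -/
theorem exists_fin_forall_notMem_of_mul_lt_measure {α : Type*} [MeasurableSpace α]
    (μ : Measure α) {S : Set α} {B : α → Set α} {C : ℝ≥0∞} (hB : ∀ a ∈ S, μ (B a) ≤ C) (k : ℕ)
    (hk : k * C < μ S) :
    ∃ a : Fin k → α, (∀ i, a i ∈ S) ∧ ∀ i j, i < j → a j ∉ B (a i) := by
  induction k with
  | zero => exact ⟨Fin.elim0, fun i => i.elim0, fun i => i.elim0⟩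
  | succ k ih =>
    obtain ⟨a, haS, haB⟩ := ih (lt_of_le_of_lt (by gcongr; simp) hk)
    obtain ⟨b, hbS, hb⟩ : ∃ b ∈ S, ∀ i, b ∉ B (a i) := by
      by_contra! h
      refine hk.not_ge ?_
      calc μ S ≤ μ (⋃ i, B (a i)) := measure_mono fun b hb => mem_iUnion.2 (h b hb)
        _ ≤ ∑ i, μ (B (a i)) := measure_iUnion_fintype_le _ _
        _ ≤ ∑ _i : Fin k, C := Finset.sum_le_sum fun i _ => hB _ (haS i)
        _ = k * C := by simp
        _ ≤ (k + 1 : ℕ) * C := by gcongr; simp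
    refine ⟨Fin.snoc (α := fun _ => α) a b, fun i => ?_, fun i j hij => ?_⟩
    · induction i using Fin.lastCases with
      | last => simpa using hbS
      | cast i => simpa using haS i
    · induction j using Fin.lastCases with
      | last =>
        induction i using Fin.lastCases with
        | last => exact absurd hij (lt_irrefl _)
        | cast i => simpa using hb i
      | cast j =>
        induction i using Fin.lastCases with
        | last => exact absurd hij (not_lt.2 (Fin.le_last _))
        | cast i => simpa using haB i j (by simpa using hij)

/-- If each of countably many properties holds eventually, then there are indices tending to
infinity along which they eventually hold. -/
theorem exists_tendsto_atTop_eventually_diagonal {P : ℕ → ℕ → Prop}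
    (h : ∀ m, ∀ᶠ n in atTop, P m n) :
    ∃ m : ℕ → ℕ, Tendsto m atTop atTop ∧ ∀ᶠ n in atTop, P (m n) n := by
  refine ⟨fun n => Nat.findGreatest (fun m => P m n) n, tendsto_atTop.2 fun b => ?_, ?_⟩
  · filter_upwards [h b, eventually_ge_atTop b] with n hn hbn
    exact Nat.le_findGreatest hbn hn
  · filter_upwards [h 0] with n hn
    exact Nat.findGreatest_spec (P := fun m => P m n) (Nat.zero_le n) hn

namespace GroupoidModel

variable {X : Type*} [TopologicalSpace X] (M : GroupoidModel X)

variable {M}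

/-- The range map. -/
def Arrow.r (γ : M.Arrow) : X := γ.1.1

/-- The source map. -/
def Arrow.s (γ : M.Arrow) : X := γ.1.2

/-- Inversion of arrows. -/
def Arrow.inv (γ : M.Arrow) : M.Arrow := ⟨(γ.1.2, γ.1.1), M.equiv.symm γ.2⟩

/-- Composition of arrows. -/
def Arrow.comp (γ δ : M.Arrow) (h : γ.s = δ.r) : M.Arrow :=
  ⟨(γ.1.1, δ.1.2), M.equiv.trans γ.2 (show M.R γ.s _ by rw [h]; exact δ.2)⟩

theorem Arrow.rel_s7 (γ : M.Arrow) : M.R γ.r γ.s := γ.2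

theorem Arrow.ext_r_s {γ δ : M.Arrow} (hr : γ.r = δ.r) (hs : γ.s = δ.s) : γ = δ :=
  Subtype.ext (Prod.ext hr hs)

theorem continuous_r : Continuous (Arrow.r : M.Arrow → X) := M.cont_r

theorem continuous_s : Continuous (Arrow.s : M.Arrow → X) := M.cont_s

theorem continuous_inv : Continuous (Arrow.inv : M.Arrow → M.Arrow) := M.cont_inv

theorem continuous_comp :
    Continuous fun q : {q : M.Arrow × M.Arrow // q.1.s = q.2.r} => q.1.1.comp q.1.2 q.2 :=
  M.cont_comp

/-- The set of products of composable pairs from `A × B`. -/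
def mulSet (A B : Set M.Arrow) : Set M.Arrow :=
  {δ | ∃ α ∈ A, ∃ β ∈ B, ∃ h : α.s = β.r, α.comp β h = δ}

theorem isCompact_mulSet [T2Space X] {A B : Set M.Arrow} (hA : IsCompact A) (hB : IsCompact B) :
    IsCompact (mulSet A B) := by
  have hc : IsClosed {q : M.Arrow × M.Arrow | q.1.s = q.2.r} :=
    isClosed_eq (continuous_s.comp continuous_fst) (continuous_r.comp continuous_snd)
  have hK := (hc.isClosedEmbedding_subtypeVal.isCompact_preimage (hA.prod hB)).image
    (continuous_comp (M := M))
  convert hK using 1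
  ext δ
  constructor
  · rintro ⟨α, hα, β, hβ, h, rfl⟩
    exact ⟨⟨(α, β), h⟩, ⟨hα, hβ⟩, rfl⟩
  · rintro ⟨⟨⟨α, β⟩, h⟩, ⟨hα, hβ⟩, rfl⟩
    exact ⟨α, hα, β, hβ, h, rfl⟩

end GroupoidModel

namespace HaarSystem

open GroupoidModel

variable {X : Type*} [TopologicalSpace X] {M : GroupoidModel X} (H : HaarSystem M)

/-- The measure `λ_x` on the type of arrows. -/
def measure (x : X) : Measure M.Arrow := H.lam x

instance (x : X) : IsFiniteMeasureOnCompacts (H.measure x) :=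
  ⟨fun {K} hK => lt_top_iff_ne_top.2 (H.finite_on_compacts x K hK)⟩

theorem ae_source_eq (x : X) : ∀ᵐ γ ∂(H.measure x), γ.s = x := H.support_null x

theorem measure_pos {x : X} {U : Set M.Arrow} (hU : IsOpen U) {γ : M.Arrow} (hγ : γ ∈ U)
    (hs : γ.s = x) : 0 < H.measure x U :=
  H.support_pos x U hU ⟨γ, hγ, hs⟩

theorem continuous_integral {f : M.Arrow → ℝ} (hf : Continuous f) (hc : HasCompactSupport f) :
    Continuous fun x => ∫ γ, f γ ∂(H.measure x) :=
  H.integral_continuous f hf hc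

theorem hasCompactSupport_integral {f : M.Arrow → ℝ} (hf : Continuous f)
    (hc : HasCompactSupport f) : HasCompactSupport fun x => ∫ γ, f γ ∂(H.measure x) :=
  H.integral_compactSupport f hf hc

theorem integrable {f : M.Arrow → ℝ} (hf : Continuous f) (hc : HasCompactSupport f) (x : X) :
    Integrable f (H.measure x) :=
  hf.integrable_of_hasCompactSupport hc

theorem integral_comp_right {f : M.Arrow → ℝ} (hf : Continuous f) (hc : HasCompactSupport f)
    (γ : M.Arrow) :
    (∫ α, (if h : α.s = γ.r then f (α.comp γ h) else 0) ∂(H.measure γ.r)) =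
      ∫ α, f α ∂(H.measure γ.s) := by
  refine Eq.trans (integral_congr_ae ?_) (H.invariance f hf hc γ)
  filter_upwards [H.ae_source_eq γ.r] with α hα
  have h : M.R α.1.1 γ.1.2 := (α.comp γ hα).rel_s7
  rw [dif_pos hα, dif_pos h]
  rfl

/-- The source map of a groupoid with a Haar system is open. -/
theorem isOpenMap_s (H : HaarSystem M) : IsOpenMap (Arrow.s : M.Arrow → X) := by
  intro U hU
  rw [isOpen_iff_mem_nhds]
  rintro _ ⟨γ, hγ, rfl⟩
  obtain ⟨f, hf1, hf0, hfc, hf⟩ := exists_continuous_one_zero_of_isCompact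
    (isCompact_singleton (x := γ)) hU.isClosed_compl
    (disjoint_compl_right_iff_subset.2 (singleton_subset_iff.2 hγ))
  have hpos : 0 < ∫ α, f α ∂(H.measure γ.s) := by
    rw [integral_pos_iff_support_of_nonneg (fun α => (hf α).1) (H.integrable f.continuous hfc _)]
    refine H.measure_pos f.continuous.isOpen_support (γ := γ) ?_ rfl
    simp [hf1 (mem_singleton γ)]
  filter_upwards [(H.continuous_integral f.continuous hfc).continuousAt.eventually
    (lt_mem_nhds hpos)] with x hx
  by_contra hxU
  refine hx.ne' (integral_eq_zero_of_ae ?_)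
  filter_upwards [H.ae_source_eq x] with α hα
  exact hf0 fun hαU => hxU ⟨α, hαU, hα⟩

theorem exists_measure_mulSet_singleton_le [T2Space X] {K : Set M.Arrow} (hK : IsCompact K) :
    ∃ C : ℝ≥0∞, C ≠ ⊤ ∧ ∀ γ : M.Arrow, H.measure γ.s (mulSet K {γ}) ≤ C := by
  obtain ⟨U, hU, hKU, hUc⟩ := exists_isOpen_superset_and_isCompact_closure hK
  obtain ⟨g, hg1, -, hgc, hg⟩ := exists_continuous_one_zero_of_isCompact hUc isClosed_empty
    (disjoint_empty _)
  obtain ⟨c, hc⟩ := (H.hasCompactSupport_integral g.continuous hgc).exists_bound_of_continuous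
    (H.continuous_integral g.continuous hgc)
  refine ⟨ENNReal.ofReal c, ENNReal.ofReal_ne_top, fun γ => ?_⟩
  have hT : Continuous fun β : {β : M.Arrow // β.s = γ.s} => β.1.comp γ.inv β.2 :=
    (continuous_comp (M := M)).comp
      ((continuous_subtype_val.prodMk continuous_const).subtype_mk fun β => β.2)
  obtain ⟨W, hW, hWU⟩ := isOpen_induced_iff.1 (hU.preimage hT)
  have hKγ : IsCompact (mulSet K {γ}) := isCompact_mulSet hK isCompact_singleton
  have hcancel : ∀ (α : M.Arrow) (h : α.s = γ.r), α.comp γ h ∈ W ↔ α ∈ U := by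
    intro α h
    have h1 : (⟨α.comp γ h, rfl⟩ : {β : M.Arrow // β.s = γ.s}) ∈ Subtype.val ⁻¹' W ↔
        (α.comp γ h).comp γ.inv rfl ∈ U := by rw [hWU]; rfl
    have h2 : (α.comp γ h).comp γ.inv rfl = α := Arrow.ext_r_s rfl h.symm
    rwa [h2] at h1
  obtain ⟨f, hf1, hf0, hfc, hf⟩ := exists_continuous_one_zero_of_isCompact hKγ
    hW.isClosed_compl (disjoint_compl_right_iff_subset.2 (by
      rintro _ ⟨α, hα, _, rfl, h, rfl⟩
      exact (hcancel α h).2 (hKU hα)))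
  have hfint := H.integrable f.continuous hfc γ.s
  calc H.measure γ.s (mulSet K {γ})
      = ∫⁻ _ in mulSet K {γ}, 1 ∂(H.measure γ.s) := by simp
    _ ≤ ∫⁻ α in mulSet K {γ}, ENNReal.ofReal (f α) ∂(H.measure γ.s) :=
        setLIntegral_mono' hKγ.measurableSet fun α hα => by simp [hf1 hα]
    _ ≤ ∫⁻ α, ENNReal.ofReal (f α) ∂(H.measure γ.s) := setLIntegral_le_lintegral _ _
    _ = ENNReal.ofReal (∫ α, f α ∂(H.measure γ.s)) :=
        (ofReal_integral_eq_lintegral_ofReal hfint (ae_of_all _ fun α => (hf α).1)).symm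
    _ ≤ ENNReal.ofReal c := by
        refine ENNReal.ofReal_le_ofReal ?_
        rw [← H.integral_comp_right f.continuous hfc γ]
        refine le_trans (integral_mono_of_nonneg (ae_of_all _ fun α => ?_)
          (H.integrable g.continuous hgc γ.r) (ae_of_all _ fun α => ?_))
          ((le_abs_self _).trans (hc γ.r))
        · dsimp only
          split_ifs with h
          exacts [(hf _).1, le_rfl]
        · dsimp only
          split_ifs with h
          · by_cases hα : α ∈ U
            · rw [hg1 (subset_closure hα)]
              exact (hf _).2
            · rw [hf0 fun hW' => hα ((hcancel α h).1 hW')]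
              exact (hg _).1
          · exact (hg _).1

/-- A point with locally closed orbit has an open neighbourhood `V` such that `G_z^V` is
relatively compact. -/
theorem exists_isOpen_source_fiber_subset_isCompact [LocallyCompactSpace X] [T2Space X]
    (H : HaarSystem M) (z : X) (hz : IsLocallyClosed (M.orbit z)) :
    ∃ V : Set X, IsOpen V ∧ z ∈ V ∧
      ∃ T : Set M.Arrow, IsCompact T ∧ ∀ γ : M.Arrow, γ.s = z → γ.r ∈ V → γ ∈ T := by
  have : LocallyCompactSpace (M.orbit z) := hz.locallyCompactSpace
  have : Nonempty (M.orbit z) := ⟨⟨z, M.equiv.refl z⟩⟩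
  let K := CompactExhaustion.choice M.Arrow
  have hcl : ∀ n, IsCompact (K n ∩ {γ : M.Arrow | γ.s = z}) := fun n =>
    (K.isCompact n).inter_right (isClosed_eq continuous_s continuous_const)
  obtain ⟨n, w, hw⟩ := nonempty_interior_of_iUnion_of_closed
    (f := fun n => (Subtype.val ⁻¹' (Arrow.r '' (K n ∩ {γ : M.Arrow | γ.s = z})) :
      Set (M.orbit z)))
    (fun n => ((hcl n).image continuous_r).isClosed.preimage continuous_subtype_val)
    (eq_univ_of_forall fun y => by
      obtain ⟨n, hn⟩ := K.exists_mem ⟨(y.1, z), y.2⟩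
      exact mem_iUnion.2 ⟨n, _, ⟨hn, rfl⟩, rfl⟩)
  obtain ⟨t, ht, htopen, hwt⟩ := mem_interior.1 hw
  obtain ⟨U, hU, rfl⟩ := isOpen_induced_iff.1 htopen
  have hUK : ∀ γ : M.Arrow, γ.s = z → γ.r ∈ U → γ ∈ K n := by
    intro γ hγ hγU
    obtain ⟨β, ⟨hβK, hβs⟩, hβ⟩ := @ht ⟨γ.r, by have := γ.rel_s7; rwa [hγ] at this⟩ hγU
    rwa [Arrow.ext_r_s (δ := β) hβ.symm (hγ.trans (Eq.symm hβs))]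
  let δ : M.Arrow := ⟨(w.1, z), w.2⟩
  obtain ⟨L, hL, hδL, hLU⟩ := exists_compact_between (isCompact_singleton (x := δ))
    (hU.preimage continuous_r) (singleton_subset_iff.2 hwt)
  refine ⟨Arrow.s '' interior L, H.isOpenMap_s _ isOpen_interior,
    ⟨δ, hδL (mem_singleton δ), rfl⟩, mulSet (Arrow.inv '' L) (K n),
    isCompact_mulSet (hL.image continuous_inv) (K.isCompact n), ?_⟩
  rintro γ hγ ⟨α, hα, hαγ⟩
  have hαL := interior_subset hα
  exact ⟨α.inv, ⟨α, hαL, rfl⟩, α.comp γ hαγ, hUK _ hγ (show α.r ∈ U from hLU hαL), rfl,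
    Arrow.ext_r_s hαγ rfl⟩

theorem measure_preimage_r_le (x : X) (V : Set X) :
    H.measure x (Arrow.r ⁻¹' V) ≤ H.measure x {γ | γ.s = x ∧ γ.r ∈ V} :=
  measure_mono_ae <| by
    filter_upwards [H.ae_source_eq x] with γ hγ hV using ⟨hγ, hV⟩

end HaarSystem

/-- In the model of a second-countable locally compact Hausdorff
principal groupoid `(X, ≈, G)` with Haar system `(λ_x)`: suppose `z ∈ X` has
locally closed orbit and `{x_n}` is a sequence in `X` such that for every open
neighbourhood `V` of `z` with `G_z^V` relatively compact, `λ_{x_n}(G^V) → ∞`.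
Then for every `k ≥ 1` the sequence `{x_n}` converges `k`-times in `X/G` to `z`. -/
theorem convergesKTimes_of_measure_tendsto_top {X : Type*} [TopologicalSpace X]
    [SecondCountableTopology X] [LocallyCompactSpace X] [T2Space X]
    (M : GroupoidModel X) (H : HaarSystem M)
    (z : X) (hz : IsLocallyClosed (M.orbit z))
    (x : ℕ → X)
    (hinf : ∀ V : Set X, IsOpen V → z ∈ V →
      @IsCompact _ M.top (@closure _ M.top (M.GsW z V)) →
      Tendsto (fun n => H.lam (x n) (M.GW V)) atTop (𝓝 ⊤)) :
    ∀ k : ℕ, 1 ≤ k → M.ConvergesKTimes k x z := by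
  open GroupoidModel in
  intro k _
  obtain ⟨V₀, hV₀, hzV₀, T, hT, hVT⟩ := H.exists_isOpen_source_fiber_subset_isCompact z hz
  obtain ⟨B, hB⟩ := (𝓝 z).exists_antitone_basis
  let V : ℕ → Set X := fun m => interior (B m) ∩ V₀
  have hV : ∀ m, Tendsto (fun n => H.measure (x n) (Arrow.r ⁻¹' V m)) atTop (𝓝 ⊤) := fun m =>
    hinf (V m) (isOpen_interior.inter hV₀) ⟨mem_interior_iff_mem_nhds.2 (hB.mem m), hzV₀⟩
      (IsCompact.closure_of_subset (X := M.Arrow) hT fun γ hγ => hVT γ hγ.1 hγ.2.2)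
  let K := CompactExhaustion.choice M.Arrow
  have hgood : ∀ m, ∀ᶠ n in atTop, ∃ a : Fin k → M.Arrow,
      (∀ i, (a i).s = x n ∧ (a i).r ∈ V m) ∧ ∀ i j, i < j → a j ∉ mulSet (K m) {a i} := by
    intro m
    obtain ⟨C, hC, hKC⟩ := H.exists_measure_mulSet_singleton_le (K.isCompact m)
    filter_upwards [(hV m).eventually (lt_mem_nhds
      (ENNReal.mul_lt_top (ENNReal.natCast_lt_top k) hC.lt_top))] with n hn
    refine exists_fin_forall_notMem_of_mul_lt_measure (H.measure (x n))
      (B := fun γ : M.Arrow => mulSet (K m) {γ}) (C := C) ?_ k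
      (hn.trans_le (H.measure_preimage_r_le (x n) (V m)))
    rintro γ ⟨hγ, -⟩
    rw [← hγ]
    exact hKC γ
  obtain ⟨m, hm, hgood⟩ := exists_tendsto_atTop_eventually_diagonal hgood
  have hchoice : ∀ n, ∃ a : Fin k → M.Arrow, (∀ i, (a i).s = x n) ∧
      ((∃ a : Fin k → M.Arrow, (∀ i, (a i).s = x n ∧ (a i).r ∈ V (m n)) ∧
        ∀ i j, i < j → a j ∉ mulSet (K (m n)) {a i}) →
      (∀ i, (a i).r ∈ V (m n)) ∧ ∀ i j, i < j → a j ∉ mulSet (K (m n)) {a i}) := by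
    intro n
    by_cases h : ∃ a : Fin k → M.Arrow, (∀ i, (a i).s = x n ∧ (a i).r ∈ V (m n)) ∧
        ∀ i j, i < j → a j ∉ mulSet (K (m n)) {a i}
    · obtain ⟨a, ha, ha'⟩ := h
      exact ⟨a, fun i => (ha i).1, fun _ => ⟨fun i => (ha i).2, ha'⟩⟩
    · exact ⟨fun _ => ⟨(x n, x n), M.equiv.refl _⟩, fun _ => rfl, fun h' => absurd h' h⟩
  choose a has ha using hchoice
  refine ⟨fun i n => a n i, fun i n => has n i, fun i => ?_, fun i j hij =>
    ⟨fun n => (a n j).comp (a n i).inv ((has n j).trans (has n i).symm), fun n => rfl, ?_⟩⟩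
  · refine (hB.tendsto_right_iff).2 fun b _ => ?_
    filter_upwards [hgood, hm.eventually_ge_atTop b] with n hn hbn
    exact hB.antitone hbn (interior_subset ((ha n hn).1 i).1)
  · intro Q hQ
    obtain ⟨b, hb⟩ := K.exists_superset_of_isCompact (s := Q) hQ
    filter_upwards [hgood, hm.eventually_ge_atTop b] with n hn hbn hmem
    exact (ha n hn).2 i j hij ⟨_, K.subset hbn (hb hmem), a n i, rfl, rfl,
      Arrow.ext_r_s rfl ((has n i).trans (has n j).symm)⟩
end

section
/- Assume the model of a second-countable locally compact Hausdorff principal groupoid (X, ≈, G) with Haar system (λ_x). Let k ≥ 1 be an integer, let z ∈ X be such that the orbit [z] is locally closed in X, and let {x_n} be a sequence in X. Assume there exists a real number R > k−1 such that for every open neighbourhood U of z with G_z^U relatively compact, liminf_n λ_{x_n}(G^U) ≥ R·λ_z(G^U). Then for every open neighbourhood V of z with G_z^V relatively compact there exists a compact neighbourhood N of z with N ⊆ V such that liminf_n λ_{x_n}(G^N) > (k−1)·λ_z(G^N). -/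
open MeasureTheory Filter Topology Set
open scoped ENNReal

attribute [local instance] Classical.propDecidable

/-- If the preimage of an open set `V` under a continuous map `r` has finite measure, then
every point of `V` has an open neighbourhood `U` and a compact neighbourhood `N` with
`U ⊆ N ⊆ V` whose preimages have the same measure. -/
lemma exists_isOpen_subset_isCompact_measure_preimage_eq {X G : Type*} [TopologicalSpace X]
    [LocallyCompactSpace X] [T2Space X] [TopologicalSpace G] [MeasurableSpace G] [BorelSpace G]
    (μ : Measure G) {r : G → X} (hr : Continuous r) {V : Set X} (hV : IsOpen V) {z : X}
    (hz : z ∈ V) (hfin : μ (r ⁻¹' V) ≠ ∞) :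
    ∃ U N : Set X, IsOpen U ∧ IsCompact N ∧ z ∈ U ∧ U ⊆ N ∧ N ⊆ V ∧
      μ (r ⁻¹' N) = μ (r ⁻¹' U) := by
  obtain ⟨f, hf1, hf0, hfc, -⟩ := exists_continuous_one_zero_of_isCompact
    (isCompact_singleton (x := z)) hV.isClosed_compl (by simpa using hz)
  have : IsFiniteMeasure (μ.restrict (r ⁻¹' V)) := ⟨by simpa using hfin.lt_top⟩
  have hcount : {t : ℝ | 0 < μ.restrict (r ⁻¹' V) {γ | f (r γ) = t}}.Countable :=
    Measure.countable_meas_level_set_pos (f.continuous.comp hr).measurable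
  obtain ⟨t, ht, ht0, ht1⟩ := (hcount.dense_compl ℝ).exists_between (zero_lt_one' ℝ)
  have hNV : f ⁻¹' Ici t ⊆ V := by
    intro y hy
    by_contra hyV
    have : t ≤ f y := hy
    rw [hf0 hyV] at this
    exact absurd this (not_le.mpr ht0)
  have hUN : f ⁻¹' Ioi t ⊆ f ⁻¹' Ici t := preimage_mono Ioi_subset_Ici_self
  have hnull : μ {γ | f (r γ) = t} = 0 := by
    have hsub : {γ | f (r γ) = t} ⊆ r ⁻¹' V := fun γ hγ => hNV (ge_of_eq hγ)
    rw [← Measure.restrict_eq_self μ hsub]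
    simpa using ht
  refine ⟨f ⁻¹' Ioi t, f ⁻¹' Ici t, isOpen_Ioi.preimage f.continuous,
    hfc.isCompact_preimage f.continuous isClosed_Ici (by simpa using ht0), ?_, hUN, hNV,
    le_antisymm ?_ (measure_mono (preimage_mono hUN))⟩
  · simpa [hf1 (mem_singleton z)] using ht1
  · calc μ (r ⁻¹' (f ⁻¹' Ici t))
        ≤ μ (r ⁻¹' (f ⁻¹' Ioi t) ∪ {γ | f (r γ) = t}) :=
          measure_mono fun γ (hγ : t ≤ f (r γ)) => (lt_or_eq_of_le hγ).imp id Eq.symm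
      _ ≤ μ (r ⁻¹' (f ⁻¹' Ioi t)) + μ {γ | f (r γ) = t} := measure_union_le _ _
      _ = μ (r ⁻¹' (f ⁻¹' Ioi t)) := by rw [hnull, add_zero]

/-- `G^V` has finite `λ_z`-measure when `G_z^V` is relatively compact. -/
lemma HaarSystem.lam_GW_ne_top {X : Type*} [TopologicalSpace X] {M : GroupoidModel X}
    (H : HaarSystem M) {z : X} {V : Set X}
    (hV : @IsCompact _ M.top (@closure _ M.top (M.GsW z V))) : H.lam z (M.GW V) ≠ ∞ := by
  let := M.top
  let : MeasurableSpace {p : X × X // M.R p.1 p.2} := borel _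
  have hsub : M.GW V ⊆ closure (M.GsW z V) ∪ {γ | γ.1.2 ≠ z} := fun γ hγ => by
    by_cases h : γ.1.2 = z
    · exact Or.inl (subset_closure ⟨h, hγ⟩)
    · exact Or.inr h
  refine ne_top_of_le_ne_top (H.finite_on_compacts z _ hV) ?_
  calc H.lam z (M.GW V) ≤ _ := measure_mono hsub
    _ ≤ _ := measure_union_le _ _
    _ = H.lam z (closure (M.GsW z V)) := by rw [H.support_null, add_zero]

/-- `G^U` has positive `λ_z`-measure for every open neighbourhood `U` of `z`. -/
lemma HaarSystem.lam_GW_pos {X : Type*} [TopologicalSpace X] {M : GroupoidModel X}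
    (H : HaarSystem M) {z : X} {U : Set X} (hU : IsOpen U) (hz : z ∈ U) :
    0 < H.lam z (M.GW U) :=
  H.support_pos z _ (@IsOpen.preimage _ _ M.top _ _ M.cont_r _ hU)
    ⟨⟨(z, z), M.equiv.refl z⟩, hz, rfl⟩

/-- In the model of a second-countable locally compact Hausdorff
principal groupoid `(X, ≈, G)` with Haar system `(λ_x)`: let `k ≥ 1`, let `z ∈ X`
have locally closed orbit, and suppose there is `R > k−1` such that for every open
neighbourhood `U` of `z` with `G_z^U` relatively compact,
`liminf_n λ_{x_n}(G^U) ≥ R·λ_z(G^U)`.  Then for every open neighbourhood `V` of `z`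
with `G_z^V` relatively compact there is a compact neighbourhood `N ⊆ V` of `z`
with `liminf_n λ_{x_n}(G^N) > (k−1)·λ_z(G^N)`. -/
theorem exists_compact_nhds_liminf_gt {X : Type*} [TopologicalSpace X]
    [SecondCountableTopology X] [LocallyCompactSpace X] [T2Space X]
    (M : GroupoidModel X) (H : HaarSystem M)
    (k : ℕ) (hk : 1 ≤ k) (z : X) (hz : IsLocallyClosed (M.orbit z))
    (x : ℕ → X) (R : ℝ) (hR : (k : ℝ) - 1 < R)
    (hbound : ∀ U : Set X, IsOpen U → z ∈ U →
      @IsCompact _ M.top (@closure _ M.top (M.GsW z U)) →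
      ENNReal.ofReal R * H.lam z (M.GW U)
        ≤ Filter.liminf (fun n => H.lam (x n) (M.GW U)) atTop) :
    ∀ V : Set X, IsOpen V → z ∈ V →
      @IsCompact _ M.top (@closure _ M.top (M.GsW z V)) →
      ∃ N : Set X, IsCompact N ∧ N ∈ 𝓝 z ∧ N ⊆ V ∧
        ((k - 1 : ℕ) : ℝ≥0∞) * H.lam z (M.GW N)
          < Filter.liminf (fun n => H.lam (x n) (M.GW N)) atTop := by
  intro V hV hzV hVc
  let := M.top
  let : MeasurableSpace {p : X × X // M.R p.1 p.2} := borel _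
  have : BorelSpace {p : X × X // M.R p.1 p.2} := ⟨rfl⟩
  obtain ⟨U, N, hU, hN, hzU, hUN, hNV, hμ⟩ :=
    exists_isOpen_subset_isCompact_measure_preimage_eq (H.lam z) M.cont_r hV hzV
      (H.lam_GW_ne_top hVc)
  change H.lam z (M.GW N) = H.lam z (M.GW U) at hμ
  have hUc : IsCompact (closure (M.GsW z U)) :=
    hVc.of_isClosed_subset isClosed_closure
      (closure_mono fun γ hγ => ⟨hγ.1, hNV (hUN hγ.2)⟩)
  have hkR : ((k - 1 : ℕ) : ℝ≥0∞) < ENNReal.ofReal R := by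
    rw [← ENNReal.ofReal_natCast, Nat.cast_sub hk, Nat.cast_one]
    have hk' : (1 : ℝ) ≤ k := by exact_mod_cast hk
    exact (ENNReal.ofReal_lt_ofReal_iff (by linarith)).mpr hR
  refine ⟨N, hN, mem_of_superset (hU.mem_nhds hzU) hUN, hNV, ?_⟩
  calc ((k - 1 : ℕ) : ℝ≥0∞) * H.lam z (M.GW N)
      = ((k - 1 : ℕ) : ℝ≥0∞) * H.lam z (M.GW U) := by rw [hμ]
    _ < ENNReal.ofReal R * H.lam z (M.GW U) :=
        ENNReal.mul_lt_mul_left (H.lam_GW_pos hU hzU).ne' (H.lam_GW_ne_top hUc) hkR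
    _ ≤ liminf (fun n => H.lam (x n) (M.GW U)) atTop := hbound U hU hzU hUc
    _ ≤ liminf (fun n => H.lam (x n) (M.GW N)) atTop :=
        liminf_le_liminf (Eventually.of_forall fun n => measure_mono (preimage_mono hUN))
end

section
/- Assume the model of a second-countable locally compact Hausdorff principal groupoid (X, ≈, G) with Haar system (λ_x). Let k ≥ 1 be an integer, let z ∈ X be such that the orbit [z] is locally closed in X, and let {x_n} be a sequence in X. Assume there exists a real number R > k−1 such that for every open neighbourhood U of z with G_z^U relatively compact, limsup_n λ_{x_n}(G^U) ≥ R·λ_z(G^U). Then for every open neighbourhood V of z with G_z^V relatively compact there exists a compact neighbourhood N of z with N ⊆ V such that limsup_n λ_{x_n}(G^N) > (k−1)·λ_z(G^N). -/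
open MeasureTheory Filter Topology Set
open scoped ENNReal

attribute [local instance] Classical.propDecidable

/-- In the model of a second-countable locally compact Hausdorff
principal groupoid `(X, ≈, G)` with Haar system `(λ_x)`: let `k ≥ 1`, let `z ∈ X`
have locally closed orbit, and suppose there is `R > k−1` such that for every open
neighbourhood `U` of `z` with `G_z^U` relatively compact,
`limsup_n λ_{x_n}(G^U) ≥ R·λ_z(G^U)`.  Then for every open neighbourhood `V` of `z`
with `G_z^V` relatively compact there is a compact neighbourhood `N ⊆ V` of `z`
with `limsup_n λ_{x_n}(G^N) > (k−1)·λ_z(G^N)`. -/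
theorem exists_compact_nhds_limsup_gt {X : Type*} [TopologicalSpace X]
    [SecondCountableTopology X] [LocallyCompactSpace X] [T2Space X]
    (M : GroupoidModel X) (H : HaarSystem M)
    (k : ℕ) (hk : 1 ≤ k) (z : X) (hz : IsLocallyClosed (M.orbit z))
    (x : ℕ → X) (R : ℝ) (hR : (k : ℝ) - 1 < R)
    (hbound : ∀ U : Set X, IsOpen U → z ∈ U →
      @IsCompact _ M.top (@closure _ M.top (M.GsW z U)) →
      ENNReal.ofReal R * H.lam z (M.GW U)
        ≤ Filter.limsup (fun n => H.lam (x n) (M.GW U)) atTop) :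
    ∀ V : Set X, IsOpen V → z ∈ V →
      @IsCompact _ M.top (@closure _ M.top (M.GsW z V)) →
      ∃ N : Set X, IsCompact N ∧ N ∈ 𝓝 z ∧ N ⊆ V ∧
        ((k - 1 : ℕ) : ℝ≥0∞) * H.lam z (M.GW N)
          < Filter.limsup (fun n => H.lam (x n) (M.GW N)) atTop := by
  intro V hVo hzV hVc
  let _ : TopologicalSpace {p : X × X // M.R p.1 p.2} := M.top
  let _ : MeasurableSpace {p : X × X // M.R p.1 p.2} := borel _
  have : BorelSpace {p : X × X // M.R p.1 p.2} := ⟨rfl⟩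
  have hr : Continuous fun γ : {p : X × X // M.R p.1 p.2} => γ.1.1 := M.cont_r
  have hVfin : H.lam z (M.GW V) < ⊤ := by
    have hsub : M.GW V ⊆ closure (M.GsW z V) ∪ {γ | γ.1.2 ≠ z} := by
      intro γ hγ
      by_cases h : γ.1.2 = z
      · exact Or.inl (subset_closure ⟨h, hγ⟩)
      · exact Or.inr h
    calc H.lam z (M.GW V)
        ≤ H.lam z (closure (M.GsW z V)) + H.lam z {γ | γ.1.2 ≠ z} :=
          (measure_mono hsub).trans (measure_union_le _ _)
      _ = H.lam z (closure (M.GsW z V)) := by rw [H.support_null, add_zero]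
      _ < ⊤ := (H.finite_on_compacts z _ hVc).lt_top
  obtain ⟨f, hf1, hf0, hfc, -⟩ := exists_continuous_one_zero_of_isCompact
    (isCompact_singleton (x := z)) hVo.isClosed_compl
    (Set.disjoint_singleton_left.2 fun h => h hzV)
  have hfz : f z = 1 := hf1 rfl
  have hfV : ∀ y, 0 < f y → y ∈ V := fun y hy => by
    by_contra h
    exact hy.ne' (hf0 h)
  have hVm : MeasurableSet (M.GW V) := (hVo.preimage hr).measurableSet
  have : IsFiniteMeasure ((H.lam z).restrict (M.GW V)) :=
    ⟨by rwa [Measure.restrict_apply_univ]⟩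
  have hcount := Measure.countable_meas_level_set_pos (μ := (H.lam z).restrict (M.GW V))
    (f.continuous.comp hr).measurable
  obtain ⟨t, ht, ht0, ht1⟩ := (hcount.dense_compl ℝ).exists_between (zero_lt_one' ℝ)
  have hnull : H.lam z (M.GW {y | f y = t}) = 0 := by
    have h0 : (H.lam z).restrict (M.GW V) (M.GW {y | f y = t}) = 0 := by
      simpa [GroupoidModel.GW, Function.comp_def] using ht
    rwa [Measure.restrict_eq_self] at h0
    intro γ hγ
    exact hfV _ (ht0.trans_eq (Eq.symm hγ))
  have hWo : IsOpen {y | t < f y} := isOpen_lt continuous_const f.continuous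
  have hzW : z ∈ {y | t < f y} := by simpa [hfz] using ht1
  have hWN : {y | t < f y} ⊆ {y | t ≤ f y} := fun y (hy : t < f y) => hy.le
  have hNV : {y | t ≤ f y} ⊆ V := fun y hy => hfV y (ht0.trans_le hy)
  have hNc : IsCompact {y | t ≤ f y} := by
    refine hfc.isCompact.of_isClosed_subset (isClosed_le continuous_const f.continuous) ?_
    intro y hy
    exact subset_tsupport _ (ht0.trans_le hy).ne'
  have hWc : IsCompact (closure (M.GsW z {y | t < f y})) :=
    hVc.of_isClosed_subset isClosed_closure
      (closure_mono fun γ hγ => ⟨hγ.1, hNV (hWN hγ.2)⟩)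
  have hle : H.lam z (M.GW {y | t ≤ f y}) ≤ H.lam z (M.GW {y | t < f y}) := by
    have hsub : M.GW {y | t ≤ f y} ⊆ M.GW {y | t < f y} ∪ M.GW {y | f y = t} := by
      intro γ hγ
      rcases (show t ≤ f γ.1.1 from hγ).lt_or_eq with h | h
      · exact Or.inl h
      · exact Or.inr h.symm
    exact ((measure_mono hsub).trans (measure_union_le _ _)).trans_eq (by rw [hnull, add_zero])
  have hpos : 0 < H.lam z (M.GW {y | t < f y}) :=
    H.support_pos z _ (hWo.preimage hr) ⟨⟨(z, z), M.equiv.refl z⟩, hzW, rfl⟩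
  have hfin : H.lam z (M.GW {y | t < f y}) ≠ ⊤ :=
    (lt_of_le_of_lt (measure_mono (show M.GW {y | t < f y} ⊆ M.GW V from
      fun γ hγ => hNV (hWN hγ))) hVfin).ne
  have hkR : ((k - 1 : ℕ) : ℝ≥0∞) < ENNReal.ofReal R := by
    rw [← ENNReal.ofReal_natCast, ENNReal.ofReal_lt_ofReal_iff_of_nonneg (Nat.cast_nonneg _)]
    rwa [Nat.cast_sub hk, Nat.cast_one]
  refine ⟨{y | t ≤ f y}, hNc, Filter.mem_of_superset (hWo.mem_nhds hzW) hWN, hNV, ?_⟩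
  calc ((k - 1 : ℕ) : ℝ≥0∞) * H.lam z (M.GW {y | t ≤ f y})
      ≤ ((k - 1 : ℕ) : ℝ≥0∞) * H.lam z (M.GW {y | t < f y}) := by gcongr
    _ < ENNReal.ofReal R * H.lam z (M.GW {y | t < f y}) :=
        ENNReal.mul_lt_mul_left hpos.ne' hfin hkR
    _ ≤ limsup (fun n => H.lam (x n) (M.GW {y | t < f y})) atTop := hbound _ hWo hzW hWc
    _ ≤ limsup (fun n => H.lam (x n) (M.GW {y | t ≤ f y})) atTop :=
        limsup_le_limsup (Eventually.of_forall fun n => measure_mono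
          (show M.GW {y | t < f y} ⊆ M.GW {y | t ≤ f y} from fun γ hγ => hWN hγ))
end

section
/- Let E be a row-finite directed graph. The path groupoid G_E is principal if and only if E contains no cycles. -/
open Filter Topology

/-- A directed graph: countable sets of vertices and edges with range and
source maps. -/
structure DirGraph where
  V : Type
  E : Type
  countV : Countable V
  countE : Countable E
  r : E → V
  s : E → V

/-- An infinite path in the directed graph `g` (edges indexed from `0`). -/
structure InfPath (g : DirGraph) where
  edge : ℕ → g.E
  chain : ∀ i, g.s (edge i) = g.r (edge (i + 1))

/-- `x ∼_k y`: the infinite paths `x` and `y` are shift equivalent with lag `k`,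
i.e. `x_i = y_{i+k}` for all sufficiently large `i`. -/
def ShiftEquiv (g : DirGraph) (x y : InfPath g) (k : ℤ) : Prop :=
  ∃ N : ℕ, 0 ≤ (N : ℤ) + k ∧ ∀ i : ℕ, N ≤ i → x.edge i = y.edge ((i : ℤ) + k).toNat

/-- The path groupoid `G_E = {(x,k,y) : x ∼_k y}` of the directed graph `g`. -/
structure PGpd (g : DirGraph) where
  xp : InfPath g
  lag : ℤ
  yp : InfPath g
  shift : ShiftEquiv g xp yp lag

/-- `α` is a (nonempty) finite path. -/
def IsFinPath (g : DirGraph) (α : List g.E) : Prop :=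
  α ≠ [] ∧ List.Chain' (fun e f => g.s e = g.r f) α

/-- The cylinder set `Z(α)` of infinite paths extending the finite path `α`. -/
def Cylinder (g : DirGraph) (α : List g.E) : Set (InfPath g) :=
  {x | ∀ (i : ℕ) (h : i < α.length), x.edge i = α.get ⟨i, h⟩}

/-- The topology on `E^∞` generated by the cylinder sets. -/
instance instTopInfPath (g : DirGraph) : TopologicalSpace (InfPath g) :=
  TopologicalSpace.generateFrom {S | ∃ α : List g.E, IsFinPath g α ∧ S = Cylinder g α}

/-- The basic set `Z(α,β)` in the path groupoid. -/
def ZSet (g : DirGraph) (α β : List g.E) : Set (PGpd g) :=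
  {γ | γ.lag = (β.length : ℤ) - (α.length : ℤ) ∧
    (∀ (i : ℕ) (h : i < α.length), γ.xp.edge i = α.get ⟨i, h⟩) ∧
    (∀ (i : ℕ) (h : i < β.length), γ.yp.edge i = β.get ⟨i, h⟩) ∧
    ∀ i : ℕ, α.length ≤ i →
      γ.xp.edge i = γ.yp.edge ((i : ℤ) + ((β.length : ℤ) - (α.length : ℤ))).toNat}

/-- The topology on the path groupoid generated by the sets `Z(α,β)` for finite
paths `α`, `β` with `s(α) = s(β)`. -/
instance instTopPGpd (g : DirGraph) : TopologicalSpace (PGpd g) :=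
  TopologicalSpace.generateFrom
    {S | ∃ (α β : List g.E) (hα : IsFinPath g α) (hβ : IsFinPath g β),
      g.s (α.getLast hα.1) = g.s (β.getLast hβ.1) ∧ S = ZSet g α β}

/-- A sequence in `G_E` tends to infinity if it eventually leaves every compact
subset of `G_E`. -/
def TendsToInftyG (g : DirGraph) (γ : ℕ → PGpd g) : Prop :=
  ∀ K : Set (PGpd g), IsCompact K → ∀ᶠ n in atTop, γ n ∉ K

/-- `{x_n}` converges `k`-times in the orbit space to `z`: there are `k` sequences
`γ^{(i)}` in `G_E` with `s(γ_n^{(i)}) = x_n`, `r(γ_n^{(i)}) → z`, and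
`γ_n^{(j)}(γ_n^{(i)})⁻¹ = (r(γ_n^{(j)}), lag_j − lag_i, r(γ_n^{(i)}))` tending to
infinity for `i < j`. -/
def ConvKTimes (g : DirGraph) (k : ℕ) (x : ℕ → InfPath g) (z : InfPath g) : Prop :=
  ∃ γ : Fin k → ℕ → PGpd g,
    (∀ i n, (γ i n).yp = x n) ∧
    (∀ i, Tendsto (fun n => (γ i n).xp) atTop (𝓝 z)) ∧
    ∀ i j : Fin k, i < j → ∃ d : ℕ → PGpd g,
      (∀ n, (d n).xp = (γ j n).xp ∧ (d n).lag = (γ j n).lag - (γ i n).lag ∧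
        (d n).yp = (γ i n).xp) ∧
      TendsToInftyG g d

/-- The infinite path `ααα⋯` obtained by repeating a cycle `α`. -/
def InfPath.ofCycle {g : DirGraph} (α : List g.E) (hα : α ≠ [])
    (hchain : List.IsChain (fun e f => g.s e = g.r f) α)
    (hcyc : g.s (α.getLast hα) = g.r (α.head hα)) : InfPath g where
  edge i := α[i % α.length]'(Nat.mod_lt _ (List.length_pos_iff.2 hα))
  chain i := by
    have hlt : i % α.length < α.length := Nat.mod_lt _ (List.length_pos_iff.2 hα)
    rcases Nat.lt_or_ge (i % α.length + 1) α.length with h | h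
    · have hmod : (i + 1) % α.length = i % α.length + 1 := by
        rw [Nat.add_mod_eq_ite, Nat.mod_eq_of_lt (a := 1) (by omega), if_neg (by omega)]
      simpa only [hmod] using List.isChain_iff_getElem.1 hchain _ h
    · have hi : i % α.length = α.length - 1 := by omega
      have hmod : (i + 1) % α.length = 0 := by
        rw [← Nat.mod_add_mod, hi, Nat.sub_add_cancel (by omega), Nat.mod_self]
      simpa only [hi, hmod, List.getLast_eq_getElem, List.head_eq_getElem] using hcyc

/-- If an infinite path visits the same edge twice, the segment in between is a cycle. -/
theorem InfPath.exists_cycle_of_edge_eq {g : DirGraph} (y : InfPath g) {m p : ℕ} (hp : 0 < p)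
    (h : y.edge m = y.edge (m + p)) :
    ∃ (α : List g.E) (hα : α ≠ []), List.IsChain (fun e f => g.s e = g.r f) α ∧
      g.s (α.getLast hα) = g.r (α.head hα) := by
  have hne : List.ofFn (fun j : Fin p => y.edge (m + j)) ≠ [] := by
    simpa [List.ofFn_eq_nil_iff] using hp.ne'
  refine ⟨_, hne, List.isChain_iff_getElem.2 fun i hi => ?_, ?_⟩
  · simpa [add_assoc] using y.chain (m + i)
  · have hlast := y.chain (m + (p - 1))
    rw [add_assoc, Nat.sub_add_cancel hp, ← h] at hlast
    simpa [List.getLast_eq_getElem, List.head_eq_getElem] using hlast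

/-- Two different lags between the same pair of infinite paths force a repeated edge. -/
theorem ShiftEquiv.exists_edge_eq {g : DirGraph} {x y : InfPath g} {k l : ℤ}
    (hk : ShiftEquiv g x y k) (hl : ShiftEquiv g x y l) (hkl : k < l) :
    ∃ m p : ℕ, 0 < p ∧ y.edge m = y.edge (m + p) := by
  obtain ⟨N, hN, hxk⟩ := hk
  obtain ⟨M, -, hxl⟩ := hl
  refine ⟨(((max N M : ℕ) : ℤ) + k).toNat, (l - k).toNat, by omega, ?_⟩
  rw [← hxk _ (le_max_left N M), hxl _ (le_max_right N M)]
  congr 1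
  omega

/-- Let `E` be a row-finite directed graph.  The path groupoid
`G_E` is principal (the map `(x,k,y) ↦ (x,y)` is injective) if and only if `E`
contains no cycles. -/
theorem pathGroupoid_principal_iff_no_cycles (g : DirGraph)
    (hrow : ∀ v : g.V, {e : g.E | g.r e = v}.Finite) :
    Function.Injective (fun γ : PGpd g => (γ.xp, γ.yp)) ↔
      ¬ ∃ (α : List g.E) (h : α ≠ []),
        List.Chain' (fun e f => g.s e = g.r f) α ∧
        g.s (α.getLast h) = g.r (α.head h) := by
  constructor
  · rintro hinj ⟨α, hα, hchain, hcyc⟩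
    let x := InfPath.ofCycle α hα hchain hcyc
    have hzero : ShiftEquiv g x x 0 := ⟨0, by simp, fun i _ => by simp⟩
    have hlen : ShiftEquiv g x x α.length := by
      refine ⟨0, by simp, fun i _ => ?_⟩
      have hnat : ((i : ℤ) + α.length).toNat = i + α.length := by omega
      simp [x, InfPath.ofCycle, hnat]
    have hlag := congrArg PGpd.lag
      (@hinj ⟨x, 0, x, hzero⟩ ⟨x, α.length, x, hlen⟩ rfl)
    have hpos := List.length_pos_iff.2 hα
    simp only at hlag
    omega
  · rintro hcyc ⟨x, k, y, hk⟩ ⟨x', l, y', hl⟩ hxy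
    obtain ⟨rfl, rfl⟩ := Prod.mk.inj hxy
    rcases lt_trichotomy k l with hkl | rfl | hkl
    · obtain ⟨m, p, hp, h⟩ := hk.exists_edge_eq hl hkl
      exact absurd (y.exists_cycle_of_edge_eq hp h) hcyc
    · rfl
    · obtain ⟨m, p, hp, h⟩ := hl.exists_edge_eq hk hkl
      exact absurd (y.exists_cycle_of_edge_eq hp h) hcyc
end

section
/- Let E be a directed graph, let x, y ∈ E^∞ be infinite paths, and let a, b ∈ ℤ with a > b. If x ∼_a y and x ∼_b y, then E contains a cycle of length a − b. -/
open Filter Topology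

/-- Let `E` be a directed graph, `x, y ∈ E^∞` infinite paths and
`a, b ∈ ℤ` with `a > b`.  If `x ∼_a y` and `x ∼_b y`, then `E` contains a cycle of
length `a − b`. -/
theorem cycle_of_two_lags (g : DirGraph) (x y : InfPath g) (a b : ℤ) (hab : b < a)
    (ha : ShiftEquiv g x y a) (hb : ShiftEquiv g x y b) :
    ∃ (α : List g.E) (h : α ≠ []),
      (α.length : ℤ) = a - b ∧
      List.Chain' (fun e f => g.s e = g.r f) α ∧
      g.s (α.getLast h) = g.r (α.head h) := by
  obtain ⟨N, hN, hxa⟩ := ha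
  obtain ⟨M, hM, hxb⟩ := hb
  obtain ⟨n, hn⟩ : ∃ n : ℕ, (n : ℤ) = a - b := ⟨(a - b).toNat, by omega⟩
  obtain ⟨m, hm⟩ : ∃ m : ℕ, (m : ℤ) = (N + M : ℕ) + b := ⟨((N + M : ℕ) + b).toNat, by omega⟩
  have hper : y.edge (m + n) = y.edge m := by
    have h1 := hxa (N + M) (by omega)
    have h2 := hxb (N + M) (by omega)
    rw [show (((N + M : ℕ) : ℤ) + a).toNat = m + n by omega] at h1
    rw [show (((N + M : ℕ) : ℤ) + b).toNat = m by omega] at h2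
    rw [← h1, h2]
  have hpos : 0 < n := by omega
  refine ⟨List.ofFn fun i : Fin n => y.edge (m + i), ?_, ?_, ?_, ?_⟩
  · simpa [List.ofFn_eq_nil_iff] using hpos.ne'
  · simpa using hn
  · refine List.isChain_iff_getElem.mpr fun i hi => ?_
    simpa [add_assoc] using y.chain (m + i)
  · rw [List.getLast_eq_getElem, List.head_eq_getElem]
    have h := y.chain (m + (n - 1))
    rw [show m + (n - 1) + 1 = m + n by omega, hper] at h
    simpa using h
end

section
/- Let E be the directed graph with vertices E⁰ = {v_n : n ≥ 1} ∪ {w_{n,m} : n ≥ 1, m ≥ 0} and edges E¹ = {e_n : n ≥ 1} ∪ {f_n^{(1)}, f_n^{(2)} : n ≥ 1} ∪ {h_{n,m} : n ≥ 1, m ≥ 0}, where r(e_n) = v_n, s(e_n) = v_{n+1}; r(f_n^{(i)}) = v_n, s(f_n^{(i)}) = w_{n,0} for i = 1, 2; and r(h_{n,m}) = w_{n,m}, s(h_{n,m}) = w_{n,m+1}. For n ≥ 1 let x^{(n)} := e₁e₂⋯e_{n−1} f_n^{(1)} h_{n,0} h_{n,1} ⋯ ∈ E^∞ and let z := e₁e₂e₃⋯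 ∈ E^∞. Then the sequence {x^{(n)}} converges 2-times in the orbit space to z. -/
open Filter Topology

/-! ### The graph of Statement 14

Vertices: `v n` (`Sum.inl n`) and `w n m` (`Sum.inr (n, m)`).
Edges: `e n = Sum.inl n` with `r(e n) = v n`, `s(e n) = v (n+1)`;
`f n i = Sum.inr (Sum.inl (n, i))` (`i : Fin 2`) with `r = v n`, `s = w n 0`;
`h n m = Sum.inr (Sum.inr (n, m))` with `r = w n m`, `s = w n (m+1)`.
(Indices are `0`-based, corresponding to `n ≥ 1` in the paper.) -/

def g14 : DirGraph where
  V := ℕ ⊕ ℕ × ℕ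
  E := ℕ ⊕ (ℕ × Fin 2 ⊕ ℕ × ℕ)
  countV := inferInstance
  countE := inferInstance
  r := fun e => match e with
    | .inl n => .inl n
    | .inr (.inl (n, _)) => .inl n
    | .inr (.inr (n, m)) => .inr (n, m)
  s := fun e => match e with
    | .inl n => .inl (n + 1)
    | .inr (.inl (n, _)) => .inr (n, 0)
    | .inr (.inr (n, m)) => .inr (n, m + 1)

/-- The edges of the infinite path `x⁽ⁿ⁾ = e₀e₁⋯e_{n-1} f_n⁽¹⁾ h_{n,0} h_{n,1} ⋯`. -/
def x14edge (n i : ℕ) : g14.E :=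
  if i < n then Sum.inl i
  else if i = n then Sum.inr (Sum.inl (n, 0))
  else Sum.inr (Sum.inr (n, i - n - 1))

/-- The infinite path `x⁽ⁿ⁾ = e₀e₁⋯e_{n-1} f_n⁽¹⁾ h_{n,0} h_{n,1} ⋯`. -/
def x14 (n : ℕ) : InfPath g14 where
  edge := x14edge n
  chain := by
    intro i
    unfold x14edge
    rcases lt_trichotomy (i + 1) n with h1 | h1 | h1
    · have h2 : i < n := by omega
      have h3 : ¬ i + 1 = n := by omega
      simp [g14, h1, h2, h3]
    · have h2 : i < n := by omega
      simp [g14, h1, h2]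
    · have h2 : ¬ i + 1 < n := by omega
      have h3 : ¬ i + 1 = n := by omega
      by_cases h4 : i = n
      · have h5 : i = n := h4
        have h6 : i + 1 - n - 1 = 0 := by omega
        simp [g14, h1, h2, h3, h5, h6]
      · have h5 : ¬ i < n := by omega
        have h6 : ¬ i = n := by omega
        have h7 : i + 1 - n - 1 = (i - n - 1) + 1 := by omega
        simp [g14, h2, h3, h5, h6, h7]

/-- The infinite path `z = e₀e₁e₂⋯`. -/
def z14 : InfPath g14 where
  edge := fun i => Sum.inl i
  chain := fun _ => rfl

/-- The finite path formed by the first `N` edges of an infinite path. -/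
def InfPath.initial {g : DirGraph} (x : InfPath g) (N : ℕ) : List g.E :=
  List.ofFn fun i : Fin N => x.edge i

theorem InfPath.length_initial {g : DirGraph} (x : InfPath g) (N : ℕ) :
    (x.initial N).length = N := by
  simp [InfPath.initial]

theorem InfPath.get_initial {g : DirGraph} (x : InfPath g) (N i : ℕ)
    (h : i < (x.initial N).length) : (x.initial N).get ⟨i, h⟩ = x.edge i := by
  simp [InfPath.initial]

theorem InfPath.isFinPath_initial {g : DirGraph} (x : InfPath g) {N : ℕ} (hN : 0 < N) :
    IsFinPath g (x.initial N) := by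
  refine ⟨List.ne_nil_of_length_pos (by rwa [x.length_initial]), ?_⟩
  refine List.isChain_iff_getElem.2 fun i hi => ?_
  simpa [InfPath.initial] using x.chain i

theorem InfPath.source_getLast_initial {g : DirGraph} (x : InfPath g) {N : ℕ} (hN : 0 < N)
    (h : x.initial N ≠ []) : g.s ((x.initial N).getLast h) = g.r (x.edge N) := by
  obtain ⟨n, rfl⟩ : ∃ n, N = n + 1 := ⟨N - 1, by omega⟩
  rw [List.getLast_eq_getElem, ← x.chain n]
  simp only [InfPath.initial, List.getElem_ofFn, List.length_ofFn, Nat.add_sub_cancel]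

/-- The elements of the path groupoid lying in some basic set `Z(α, β)` with `|α| ≤ M`. -/
def shortZSets (g : DirGraph) (M : ℕ) : Set (PGpd g) :=
  ⋃₀ {S | ∃ (α β : List g.E) (hα : IsFinPath g α) (hβ : IsFinPath g β),
    α.length ≤ M ∧ g.s (α.getLast hα.1) = g.s (β.getLast hβ.1) ∧ S = ZSet g α β}

theorem isOpen_shortZSets (g : DirGraph) (M : ℕ) : IsOpen (shortZSets g M) := by
  refine isOpen_sUnion ?_
  rintro S ⟨α, β, hα, hβ, -, hs, rfl⟩
  exact TopologicalSpace.isOpen_generateFrom_of_mem ⟨α, β, hα, hβ, hs, rfl⟩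

theorem monotone_shortZSets (g : DirGraph) : Monotone (shortZSets g) := by
  rintro M M' hM γ ⟨S, ⟨α, β, hα, hβ, hl, hs, rfl⟩, hγ⟩
  exact ⟨_, ⟨α, β, hα, hβ, hl.trans hM, hs, rfl⟩, hγ⟩

theorem exists_mem_shortZSets {g : DirGraph} (γ : PGpd g) : ∃ M, γ ∈ shortZSets g M := by
  obtain ⟨a, k, b, N, hN, h⟩ := γ
  obtain ⟨L, hL⟩ : ∃ L : ℕ, (L : ℤ) = (N + 1 : ℕ) + k := ⟨(N + 1 + k).toNat, by omega⟩
  have hk : k = (L : ℤ) - (N + 1 : ℕ) := by omega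
  have hL0 : 0 < L := by omega
  have hα := a.isFinPath_initial N.succ_pos
  have hβ := b.isFinPath_initial hL0
  refine ⟨N + 1, _, ⟨a.initial (N + 1), b.initial L, hα, hβ, (a.length_initial _).le, ?_, rfl⟩, ?_⟩
  · rw [a.source_getLast_initial N.succ_pos, b.source_getLast_initial hL0, h (N + 1) (by omega),
      ← hL, Int.toNat_natCast]
  · refine ⟨?_, fun i hi => (a.get_initial _ i hi).symm, fun i hi => (b.get_initial _ i hi).symm,
      fun i hi => ?_⟩
    · simpa only [InfPath.length_initial] using hk
    · rw [InfPath.length_initial] at hi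
      simp only [InfPath.length_initial, ← hk]
      exact h i (by omega)

theorem IsCompact.exists_subset_shortZSets {g : DirGraph} {K : Set (PGpd g)} (hK : IsCompact K) :
    ∃ M, K ⊆ shortZSets g M :=
  hK.elim_directed_cover _ (isOpen_shortZSets g)
    (fun γ _ => Set.mem_iUnion.2 (exists_mem_shortZSets γ))
    (monotone_shortZSets g).directed_le

theorem edge_eq_of_mem_shortZSets {g : DirGraph} {γ : PGpd g} {M : ℕ} (hγ : γ ∈ shortZSets g M)
    (hlag : γ.lag = 0) {i : ℕ} (hi : M ≤ i) : γ.xp.edge i = γ.yp.edge i := by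
  obtain ⟨S, ⟨α, β, -, -, hl, -, rfl⟩, hk, -, -, h⟩ := hγ
  have := h i (hl.trans hi)
  rwa [← hk, hlag, add_zero, Int.toNat_natCast] at this

/-- Lag-zero elements whose range and source differ ever further out tend to infinity. -/
theorem tendsToInftyG_of_edge_ne {g : DirGraph} {d : ℕ → PGpd g} (hlag : ∀ n, (d n).lag = 0)
    (hne : ∀ n, (d n).xp.edge n ≠ (d n).yp.edge n) : TendsToInftyG g d := by
  intro K hK
  obtain ⟨M, hM⟩ := hK.exists_subset_shortZSets
  filter_upwards [eventually_ge_atTop M] with n hn hd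
  exact hne n (edge_eq_of_mem_shortZSets (hM hd) (hlag n) hn)

theorem InfPath.tendsto_of_edge_eq {g : DirGraph} {y : ℕ → InfPath g} {z : InfPath g}
    (h : ∀ n i, i < n → (y n).edge i = z.edge i) : Tendsto y atTop (𝓝 z) := by
  rw [TopologicalSpace.tendsto_nhds_generateFrom_iff]
  rintro S ⟨α, -, rfl⟩ hz
  filter_upwards [eventually_ge_atTop α.length] with n hn i hi
  rw [h n i (hi.trans_le hn), hz i hi]

/-- The edge `v n ← w n 0` numbered `c`. -/
def parallelEdge14 (c : Fin 2) (n : ℕ) : g14.E :=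
  Sum.inr (Sum.inl (n, c))

theorem parallelEdge14_injective (n : ℕ) : Function.Injective fun c => parallelEdge14 c n :=
  fun _ _ h => congrArg Prod.snd (Sum.inl_injective (Sum.inr_injective h))

theorem x14edge_self (n : ℕ) : x14edge n n = parallelEdge14 0 n :=
  (if_neg (lt_irrefl n)).trans (if_pos rfl)

/-- The path obtained from `x14 n` by replacing the edge `v n ← w n 0` by the parallel edge
numbered `c`. -/
def branch14 (c : Fin 2) (n : ℕ) : InfPath g14 where
  edge i := if i = n then parallelEdge14 c n else x14edge n i
  chain i := by
    have hs : ∀ j, g14.s (if j = n then parallelEdge14 c n else x14edge n j) =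
        g14.s (x14edge n j) := by
      intro j
      split_ifs with h
      · rw [h, x14edge_self]; rfl
      · rfl
    have hr : ∀ j, g14.r (if j = n then parallelEdge14 c n else x14edge n j) =
        g14.r (x14edge n j) := by
      intro j
      split_ifs with h
      · rw [h, x14edge_self]; rfl
      · rfl
    rw [hs, hr]
    exact (x14 n).chain i

theorem branch14_edge_of_ne (c : Fin 2) {n i : ℕ} (h : i ≠ n) :
    (branch14 c n).edge i = x14edge n i :=
  if_neg h

theorem branch14_edge_self (c : Fin 2) (n : ℕ) :
    (branch14 c n).edge n = parallelEdge14 c n :=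
  if_pos rfl

theorem tendsto_branch14 (c : Fin 2) : Tendsto (branch14 c) atTop (𝓝 z14) :=
  InfPath.tendsto_of_edge_eq fun _ _ hi =>
    (branch14_edge_of_ne c hi.ne).trans (if_pos hi)

theorem shiftEquiv_zero_of_edge_eq {g : DirGraph} {x y : InfPath g} (N : ℕ)
    (h : ∀ i, N ≤ i → x.edge i = y.edge i) : ShiftEquiv g x y 0 :=
  ⟨N, by simp, fun i hi => by simpa using h i hi⟩

/-- For the graph above, the sequence `{x⁽ⁿ⁾}` converges
`2`-times in the orbit space to `z`. -/
theorem x14_converges_two_times : ConvKTimes g14 2 x14 z14 := by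
  refine ⟨fun c n => ⟨branch14 c n, 0, x14 n, shiftEquiv_zero_of_edge_eq (n + 1) fun i hi =>
    branch14_edge_of_ne c (by omega)⟩, fun _ _ => rfl, tendsto_branch14, fun c c' hc => ?_⟩
  refine ⟨fun n => ⟨branch14 c' n, 0, branch14 c n, shiftEquiv_zero_of_edge_eq (n + 1) fun i hi =>
    ?_⟩, fun n => ⟨rfl, by simp, rfl⟩, tendsToInftyG_of_edge_ne (fun _ => rfl) fun n h => ?_⟩
  · rw [branch14_edge_of_ne c' (by omega), branch14_edge_of_ne c (by omega)]
  · simp only [branch14_edge_self] at h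
    exact hc.ne' (parallelEdge14_injective n h)
end

section
/- Fix an integer k ≥ 1. Let E be the directed graph with vertices E⁰ = {v_n : n ≥ 1} ∪ {w_{n,m} : n ≥ 1, m ≥ 0} and edges E¹ = {e_n : n ≥ 1} ∪ {f_n^{(1)}, …, f_n^{(k)} : n ≥ 1} ∪ {h_{n,m} : n ≥ 1, m ≥ 0}, where r(e_n) = v_n, s(e_n) = v_{n+1}; r(f_n^{(i)}) = v_n, s(f_n^{(i)}) = w_{n,0} for 1 ≤ i ≤ k; and r(h_{n,m}) = w_{n,m}, s(h_{n,m}) = w_{n,m+1}. For n ≥ 1 let x^{(n)} := e₁e₂⋯e_{n−1} f_n^{(1)} h_{n,0} h_{n,1} ⋯ ∈ E^∞ and let z := e₁e₂e₃⋯ ∈ E^∞. Then the sequence {x^{(n)}} converges k-times in the orbit space to z. -/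
open Filter Topology

/-! ### The graph of Statement 15

For a fixed integer `k ≥ 1`:
vertices: `v n` (`Sum.inl n`) and `w n m` (`Sum.inr (n, m)`);
edges: `e n = Sum.inl n` with `r(e n) = v n`, `s(e n) = v (n+1)`;
`f n i = Sum.inr (Sum.inl (n, i))` (`i : Fin k`) with `r = v n`, `s = w n 0`;
`h n m = Sum.inr (Sum.inr (n, m))` with `r = w n m`, `s = w n (m+1)`.
(Indices are `0`-based, corresponding to `n ≥ 1` in the paper.) -/

def g15 (k : ℕ) : DirGraph where
  V := ℕ ⊕ ℕ × ℕ
  E := ℕ ⊕ (ℕ × Fin k ⊕ ℕ × ℕ)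
  countV := inferInstance
  countE := inferInstance
  r := fun e => match e with
    | .inl n => .inl n
    | .inr (.inl (n, _)) => .inl n
    | .inr (.inr (n, m)) => .inr (n, m)
  s := fun e => match e with
    | .inl n => .inl (n + 1)
    | .inr (.inl (n, _)) => .inr (n, 0)
    | .inr (.inr (n, m)) => .inr (n, m + 1)

/-- The edges of the infinite path `x⁽ⁿ⁾ = e₀e₁⋯e_{n-1} f_n⁽¹⁾ h_{n,0} h_{n,1} ⋯`. -/
def x15edge (k : ℕ) (hk : 0 < k) (n i : ℕ) : (g15 k).E :=
  if i < n then Sum.inl i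
  else if i = n then Sum.inr (Sum.inl (n, ⟨0, hk⟩))
  else Sum.inr (Sum.inr (n, i - n - 1))

/-- The infinite path `x⁽ⁿ⁾ = e₀e₁⋯e_{n-1} f_n⁽¹⁾ h_{n,0} h_{n,1} ⋯`. -/
def x15 (k : ℕ) (hk : 0 < k) (n : ℕ) : InfPath (g15 k) where
  edge := x15edge k hk n
  chain := by
    intro i
    unfold x15edge
    rcases lt_trichotomy (i + 1) n with h1 | h1 | h1
    · have h2 : i < n := by omega
      have h3 : ¬ i + 1 = n := by omega
      simp [g15, h1, h2, h3]
    · have h2 : i < n := by omega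
      simp [g15, h1, h2]
    · have h2 : ¬ i + 1 < n := by omega
      have h3 : ¬ i + 1 = n := by omega
      by_cases h4 : i = n
      · have h5 : i = n := h4
        have h6 : i + 1 - n - 1 = 0 := by omega
        simp [g15, h1, h2, h3, h5, h6]
      · have h5 : ¬ i < n := by omega
        have h6 : ¬ i = n := by omega
        have h7 : i + 1 - n - 1 = (i - n - 1) + 1 := by omega
        simp [g15, h2, h3, h5, h6, h7]

/-- The infinite path `z = e₀e₁e₂⋯`. -/
def z15 (k : ℕ) : InfPath (g15 k) where
  edge := fun i => Sum.inl i
  chain := fun _ => rfl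

/-- The finite path formed by the first `n` edges of an infinite path. -/
def InfPath.take {g : DirGraph} (x : InfPath g) (n : ℕ) : List g.E :=
  List.ofFn fun t : Fin n => x.edge t

theorem InfPath.length_take {g : DirGraph} (x : InfPath g) (n : ℕ) : (x.take n).length = n := by
  simp [InfPath.take]

theorem InfPath.get_take {g : DirGraph} (x : InfPath g) (n i : ℕ) (h : i < (x.take n).length) :
    (x.take n).get ⟨i, h⟩ = x.edge i := by
  simp [InfPath.take]

theorem InfPath.isFinPath_take_succ {g : DirGraph} (x : InfPath g) (n : ℕ) :
    IsFinPath g (x.take (n + 1)) := by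
  refine ⟨by simp [InfPath.take], ?_⟩
  refine List.isChain_iff_getElem.2 fun i h => ?_
  simpa [InfPath.take, -List.ofFn_succ] using x.chain i

theorem InfPath.getLast_take_succ {g : DirGraph} (x : InfPath g) (n : ℕ)
    (h : x.take (n + 1) ≠ []) : (x.take (n + 1)).getLast h = x.edge n := by
  simp [InfPath.take, List.getLast_ofFn, -List.ofFn_succ]

/-- The basic sets `Z(α,β)` cover the path groupoid. -/
theorem exists_mem_ZSet {g : DirGraph} (γ : PGpd g) :
    ∃ α β : List g.E, IsOpen (ZSet g α β) ∧ γ ∈ ZSet g α β := by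
  obtain ⟨N, hN, hshift⟩ := γ.shift
  obtain ⟨M, hM⟩ := Int.eq_ofNat_of_zero_le hN
  have hlag : ((M + 1 : ℕ) : ℤ) - ((N + 1 : ℕ) : ℤ) = γ.lag := by omega
  refine ⟨γ.xp.take (N + 1), γ.yp.take (M + 1),
    TopologicalSpace.isOpen_generateFrom_of_mem
      ⟨_, _, γ.xp.isFinPath_take_succ N, γ.yp.isFinPath_take_succ M, ?_, rfl⟩, ?_⟩
  · rw [InfPath.getLast_take_succ, InfPath.getLast_take_succ, InfPath.chain, InfPath.chain,
      hshift (N + 1) (by omega)]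
    congr 2
    omega
  · refine ⟨?_, fun i h => (γ.xp.get_take _ i h).symm, fun i h => (γ.yp.get_take _ i h).symm, ?_⟩
    · rw [InfPath.length_take, InfPath.length_take, hlag]
    · intro i hi
      rw [InfPath.length_take] at hi
      rw [InfPath.length_take, InfPath.length_take, hlag]
      exact hshift i (by omega)

/-- A sequence that eventually leaves every basic set `Z(α,β)` tends to infinity. -/
theorem tendsToInftyG_of_eventually_notMem_ZSet {g : DirGraph} {d : ℕ → PGpd g}
    (hd : ∀ α β : List g.E, ∀ᶠ n in atTop, d n ∉ ZSet g α β) : TendsToInftyG g d := by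
  intro K hK
  refine hK.induction_on (p := fun S => ∀ᶠ n in atTop, d n ∉ S) (by simp)
    (fun S T hST hT => hT.mono fun n hn h => hn (hST h)) ?_ ?_
  · intro S T hS hT
    filter_upwards [hS, hT] with n hnS hnT h
    exact h.elim hnS hnT
  · intro γ _
    obtain ⟨α, β, hopen, hmem⟩ := exists_mem_ZSet γ
    exact ⟨_, mem_nhdsWithin_of_mem_nhds (hopen.mem_nhds hmem), hd α β⟩

/-- The infinite path `e₀e₁⋯e_{n-1} f_n⁽ⁱ⁾ h_{n,0} h_{n,1} ⋯`. -/
def branchPath (k : ℕ) (i : Fin k) (n : ℕ) : InfPath (g15 k) where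
  edge t :=
    if t < n then Sum.inl t
    else if t = n then Sum.inr (Sum.inl (n, i))
    else Sum.inr (Sum.inr (n, t - n - 1))
  chain := by
    intro t
    rcases lt_trichotomy (t + 1) n with h | h | h
    · simp [g15, h, show t < n by omega]
    · simp [g15, h, show t < n by omega]
    · rcases eq_or_ne t n with rfl | hne
      · simp [g15]
      · simp [g15, hne, show ¬ t + 1 < n by omega, show ¬ t + 1 = n by omega,
          show ¬ t < n by omega, show t + 1 - n - 1 = t - n - 1 + 1 by omega]

theorem branchPath_zero (k : ℕ) (hk : 0 < k) (n : ℕ) :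
    branchPath k ⟨0, hk⟩ n = x15 k hk n :=
  rfl

theorem branchPath_edge_of_lt {k : ℕ} (i : Fin k) {n t : ℕ} (h : t < n) :
    (branchPath k i n).edge t = Sum.inl t :=
  if_pos h

theorem branchPath_edge_self {k : ℕ} (i : Fin k) (n : ℕ) :
    (branchPath k i n).edge n = Sum.inr (Sum.inl (n, i)) :=
  (if_neg (lt_irrefl n)).trans (if_pos rfl)

theorem branchPath_edge_of_gt {k : ℕ} (i : Fin k) {n t : ℕ} (h : n < t) :
    (branchPath k i n).edge t = Sum.inr (Sum.inr (n, t - n - 1)) :=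
  (if_neg h.not_gt).trans (if_neg h.ne')

/-- The groupoid element of lag `0` from `branchPath k j n` to `branchPath k i n`. -/
def branchArrow (k : ℕ) (i j : Fin k) (n : ℕ) : PGpd (g15 k) where
  xp := branchPath k i n
  lag := 0
  yp := branchPath k j n
  shift := by
    refine ⟨n + 1, by omega, fun t ht => ?_⟩
    rw [add_zero, Int.toNat_natCast, branchPath_edge_of_gt i ht, branchPath_edge_of_gt j ht]

theorem tendsto_branchPath (k : ℕ) (i : Fin k) :
    Tendsto (branchPath k i) atTop (𝓝 (z15 k)) := by
  refine TopologicalSpace.tendsto_nhds_generateFrom_iff.2 ?_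
  rintro _ ⟨α, _, rfl⟩ hz
  filter_upwards [eventually_ge_atTop α.length] with n hn t ht
  rw [branchPath_edge_of_lt i (ht.trans_le hn), ← hz t ht]
  rfl

theorem tendsToInftyG_branchArrow (k : ℕ) {i j : Fin k} (hij : i ≠ j) :
    TendsToInftyG (g15 k) (branchArrow k i j) := by
  refine tendsToInftyG_of_eventually_notMem_ZSet fun α β => ?_
  filter_upwards [eventually_ge_atTop α.length] with n hn
  rintro ⟨hlag, -, -, htail⟩
  have h := htail n hn
  rw [← hlag] at h
  change (branchPath k i n).edge n = (branchPath k j n).edge ((n : ℤ) + 0).toNat at h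
  rw [add_zero, Int.toNat_natCast, branchPath_edge_self, branchPath_edge_self] at h
  exact hij (Prod.ext_iff.1 (Sum.inl_injective (Sum.inr_injective h))).2

/-- For the graph above (with `k ≥ 1`), the sequence `{x⁽ⁿ⁾}`
converges `k`-times in the orbit space to `z`. -/
theorem x15_converges_k_times (k : ℕ) (hk : 1 ≤ k) :
    ConvKTimes (g15 k) k (x15 k hk) (z15 k) := by
  exact ⟨fun i n => branchArrow k i ⟨0, hk⟩ n, fun _ n => branchPath_zero k hk n,
    fun i => tendsto_branchPath k i, fun i j hij => ⟨branchArrow k j i,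
      fun _ => ⟨rfl, rfl, rfl⟩, tendsToInftyG_branchArrow k hij.ne'⟩⟩
end
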